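/- Let i and j be real numbers with 0 < i, j < 1 and i + j = 1, set σ := min{i, j}, and let θ ∈ ℝ². Let a ∈ ℚ with a ≠ 0 and b ∈ ℝ, and let L_{a,b} := {(x, ax + b) : x ∈ ℝ}. Suppose that liminf_{q→∞} q^{1/σ} · max{‖qa‖, ‖qb‖} > 0, where the liminf is over positive integers q. Then the Hausdorff dimension of Bad_θ(i,j) ∩ L_{a,b} equals 1. -/

import Mathlib

open Filter Set

/-- Distance from a real number to the nearest integer. -/
noncomputable def distNearestInt (t : ℝ) : ℝ := |t - round t|

/-- The inhomogeneous set `Bad_θ(i,j)` of `(i,j)`-badly approximable pairs. -/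
def badPair (i j : ℝ) (θ : ℝ × ℝ) : Set (ℝ × ℝ) :=
  {p : ℝ × ℝ | ∃ c : ℝ, 0 < c ∧ ∀ q : ℕ, 0 < q →
    c / (q : ℝ) < max (distNearestInt ((q : ℝ) * p.1 - θ.1) ^ (1 / i))
                      (distNearestInt ((q : ℝ) * p.2 - θ.2) ^ (1 / j))}


section Tree
open scoped ENNReal

/-- own debt -/
noncomputable def ownDebt {R : ℕ} (t : ℝ≥0∞) (κ : ℕ → List (Fin R) → List (Fin R))
    (w v : List (Fin R)) : ℝ≥0∞ :=
  ∑' k, if κ k w = v then (t⁻¹) ^ v.length else 0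

/-- total pending debt at `w` located at `v ++ w` -/
noncomputable def debt {R : ℕ} (t : ℝ≥0∞) (κ : ℕ → List (Fin R) → List (Fin R)) :
    List (Fin R) → List (Fin R) → ℝ≥0∞
  | [], v => ownDebt t κ [] v
  | r :: w, v => t * debt t κ w (v ++ [r]) + ownDebt t κ (r :: w) v

/-- the good tree -/
def inTree {R : ℕ} (t : ℝ≥0∞) (κ : ℕ → List (Fin R) → List (Fin R)) : List (Fin R) → Prop
  | [] => True
  | r :: w => inTree t κ w ∧ ∑' v, t * debt t κ w (v ++ [r]) ≤ 1 / 2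

lemma ownDebt_sum {R : ℕ} (t : ℝ≥0∞) (κ : ℕ → List (Fin R) → List (Fin R)) (ℓ : ℕ → ℕ)
    (hlen : ∀ k w, (κ k w).length = ℓ k) (hsum : ∑' k, (t⁻¹) ^ (ℓ k) ≤ 1 / 2)
    (w : List (Fin R)) : ∑' v, ownDebt t κ w v ≤ 1 / 2 := by
  unfold ownDebt
  rw [ENNReal.tsum_comm]
  refine le_trans (le_of_eq ?_) hsum
  refine tsum_congr fun k => ?_
  rw [tsum_eq_single (κ k w)]
  · simp [hlen]
  · intro v hv
    rw [if_neg (Ne.symm hv)]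

lemma debt_sum {R : ℕ} (t : ℝ≥0∞) (κ : ℕ → List (Fin R) → List (Fin R)) (ℓ : ℕ → ℕ)
    (hlen : ∀ k w, (κ k w).length = ℓ k) (hsum : ∑' k, (t⁻¹) ^ (ℓ k) ≤ 1 / 2)
    (w : List (Fin R)) (hw : inTree t κ w) : ∑' v, debt t κ w v ≤ 1 := by
  cases w with
  | nil =>
    simp only [debt]
    refine (ownDebt_sum t κ ℓ hlen hsum []).trans ?_
    simp
  | cons r w =>
    simp only [debt]
    rw [ENNReal.tsum_add]
    calc _ ≤ (1 / 2 : ℝ≥0∞) + 1 / 2 := add_le_add hw.2 (ownDebt_sum t κ ℓ hlen hsum _)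
      _ = 1 := ENNReal.add_halves 1

lemma children_sum {R : ℕ} (t : ℝ≥0∞) (κ : ℕ → List (Fin R) → List (Fin R)) (w : List (Fin R)) :
    ∑ r : Fin R, ∑' v, t * debt t κ w (v ++ [r]) ≤ t * ∑' v, debt t κ w v := by
  have h1 : ∀ r : Fin R, ∑' v, t * debt t κ w (v ++ [r]) = t * ∑' v, debt t κ w (v ++ [r]) :=
    fun r => ENNReal.tsum_mul_left
  simp only [h1]
  rw [← Finset.mul_sum]
  gcongr
  rw [← tsum_fintype (L := SummationFilter.unconditional _), ← ENNReal.tsum_prod]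
  have hinj : Function.Injective (fun p : Fin R × List (Fin R) => p.2 ++ [p.1]) := by
    rintro ⟨r, v⟩ ⟨r', v'⟩ h
    simp only at h
    have := List.append_inj' h rfl
    simp at this
    simp [this]
  exact ENNReal.tsum_comp_le_tsum_of_injective hinj (debt t κ w)

lemma debt_ge {R : ℕ} (t : ℝ≥0∞) (ht0 : t ≠ 0) (htt : t ≠ ⊤)
    (κ : ℕ → List (Fin R) → List (Fin R)) (k : ℕ) (w' : List (Fin R)) :
    ∀ (s v : List (Fin R)), κ k w' = v ++ s → (t⁻¹) ^ v.length ≤ debt t κ (s ++ w') v := by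
  have own : ∀ v, κ k w' = v → (t⁻¹) ^ v.length ≤ ownDebt t κ w' v := by
    intro v hv
    unfold ownDebt
    refine le_trans ?_ (ENNReal.le_tsum k)
    rw [if_pos hv]
  intro s
  induction s with
  | nil =>
    intro v hv
    have h := own v (by simpa using hv)
    cases w' with
    | nil => simpa [debt] using h
    | cons r w => simp only [List.nil_append, debt]; exact h.trans (by simp)
  | cons r s ih =>
    intro v hv
    simp only [List.cons_append, debt]
    have := ih (v ++ [r]) (by simp [hv])
    refine le_trans ?_ (le_add_right (mul_le_mul_right this t))
    rw [List.length_append, List.length_singleton, pow_succ, mul_comm, mul_assoc,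
      ENNReal.inv_mul_cancel ht0 htt, mul_one]

theorem tree_exists (N : ℕ) (hN : 0 < N) (κ : ℕ → List (Fin (2 * N)) → List (Fin (2 * N)))
    (ℓ : ℕ → ℕ) (hlen : ∀ k w, (κ k w).length = ℓ k) (hpos : ∀ k, 1 ≤ ℓ k)
    (hsum : ∑' k, (((N : ℝ≥0∞) / 2)⁻¹) ^ (ℓ k) ≤ 1 / 2) :
    ∃ T : Set (List (Fin (2 * N))), [] ∈ T ∧ (∀ r w, r :: w ∈ T → w ∈ T) ∧
      (∀ w ∈ T, ∃ f : Fin N → Fin (2 * N), Function.Injective f ∧ ∀ e, f e :: w ∈ T) ∧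
      ∀ k w, κ k w ++ w ∉ T := by
  classical
  set t : ℝ≥0∞ := (N : ℝ≥0∞) / 2 with ht
  have ht0 : t ≠ 0 := by
    rw [ht]; simp; omega
  have htt : t ≠ ⊤ := by
    rw [ht]; exact ENNReal.div_ne_top (by simp) (by simp)
  refine ⟨{w | inTree t κ w}, trivial, fun r w h => h.1, ?_, ?_⟩
  · intro w hw
    have hD := debt_sum t κ ℓ hlen hsum w hw
    have hC := (children_sum t κ w).trans (mul_le_mul_right hD t)
    rw [mul_one] at hC
    set I : Fin (2 * N) → ℝ≥0∞ := fun r => ∑' v, t * debt t κ w (v ++ [r]) with hI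
    set G : Finset (Fin (2 * N)) := Finset.univ.filter fun r => I r ≤ 1 / 2 with hG
    have hcard : N ≤ G.card := by
      by_contra hlt
      push Not at hlt
      set G' : Finset (Fin (2 * N)) := Finset.univ.filter fun r => ¬ I r ≤ 1 / 2 with hG'
      have hsumc : G.card + G'.card = 2 * N := by
        rw [hG, hG', Finset.card_filter_add_card_filter_not]; simp
      have hne : N + 1 ≤ G'.card := by omega
      have h1 : (G'.card : ℝ≥0∞) * (1 / 2) ≤ ∑ r ∈ G', I r := by
        rw [← nsmul_eq_mul]
        apply Finset.card_nsmul_le_sum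
        intro r hr
        have := (Finset.mem_filter.1 hr).2
        exact (not_le.1 this).le
      have h2 : ∑ r ∈ G', I r ≤ t :=
        (Finset.sum_le_sum_of_subset (Finset.subset_univ _)).trans hC
      have h3 : ((N + 1 : ℕ) : ℝ≥0∞) * (1 / 2) ≤ t :=
        le_trans (by gcongr) (h1.trans h2)
      have h4 : t < ((N + 1 : ℕ) : ℝ≥0∞) * (1 / 2) := by
        rw [ht, one_div, ← div_eq_mul_inv]
        apply ENNReal.div_lt_div_right (by simp) (by simp)
        exact_mod_cast Nat.lt_succ_self N
      exact absurd h3 (not_le.2 h4)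
    obtain ⟨S, hS, hSc⟩ := Finset.exists_subset_card_eq hcard
    refine ⟨fun e => S.orderEmbOfFin hSc e, (S.orderEmbOfFin hSc).injective, fun e => ?_⟩
    have : S.orderEmbOfFin hSc e ∈ G := hS (S.orderEmbOfFin_mem hSc e)
    exact ⟨hw, (Finset.mem_filter.1 this).2⟩
  · intro k w h
    have hl := hlen k w
    obtain ⟨r, s, hrs⟩ : ∃ r s, κ k w = r :: s := by
      cases hk : κ k w with
      | nil => rw [hk] at hl; have := hpos k; simp at hl; omega
      | cons r s => exact ⟨r, s, rfl⟩
    rw [hrs] at h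
    have h1 := debt_ge t ht0 htt κ k w s [r] (by simp [hrs])
    have h2 : ∑' v, t * debt t κ (s ++ w) (v ++ [r]) ≤ 1 / 2 := h.2
    have h3 := (ENNReal.le_tsum (f := fun v => t * debt t κ (s ++ w) (v ++ [r])) []).trans h2
    have h4 : (1 : ℝ≥0∞) ≤ t * debt t κ (s ++ w) ([] ++ [r]) := by
      calc (1 : ℝ≥0∞) = t * t⁻¹ := (ENNReal.mul_inv_cancel ht0 htt).symm
        _ ≤ _ := by
          refine mul_le_mul_right ?_ t
          simpa using h1
    have h5 := h4.trans h3
    have : (1 / 2 : ℝ≥0∞) < 1 := by simp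
    exact absurd h5 (not_le.2 this)

end Tree


section Cells
open scoped ENNReal NNReal

/-- position of a word -/
def wpos (N : ℕ) : List (Fin (2 * N)) → ℕ
  | [] => 0
  | r :: w => 4 * N * wpos N w + 2 * r.val

/-- interval attached to a word -/
def cell (N : ℕ) (ρ : ℝ) (w : List (Fin (2 * N))) : Set ℝ :=
  Icc (ρ * wpos N w / (4 * N : ℝ) ^ w.length) (ρ * (wpos N w + 1) / (4 * N : ℝ) ^ w.length)

lemma cell_cons (N : ℕ) (hN : 0 < N) (ρ : ℝ) (hρ : 0 < ρ) (r : Fin (2 * N))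
    (w : List (Fin (2 * N))) : cell N ρ (r :: w) ⊆ cell N ρ w := by
  have hN' : (0 : ℝ) < N := by exact_mod_cast hN
  have hr : ((r.val : ℝ)) + 1 ≤ 2 * N := by exact_mod_cast r.isLt
  have hr0 : (0 : ℝ) ≤ (r.val : ℝ) := by positivity
  apply Icc_subset_Icc
  · simp only [wpos, List.length_cons, pow_succ]
    push_cast
    rw [div_le_div_iff₀ (by positivity) (by positivity)]
    have : 0 ≤ ρ * (2 * (r.val : ℝ)) * (4 * N : ℝ) ^ w.length := by positivity
    nlinarith
  · simp only [wpos, List.length_cons, pow_succ]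
    push_cast
    rw [div_le_div_iff₀ (by positivity) (by positivity)]
    have : 0 ≤ ρ * (4 * N - 2 * (r.val : ℝ) - 1) * (4 * N : ℝ) ^ w.length := by
      have : 0 ≤ 4 * N - 2 * (r.val : ℝ) - 1 := by linarith
      positivity
    nlinarith

lemma cell_append (N : ℕ) (hN : 0 < N) (ρ : ℝ) (hρ : 0 < ρ) (u w : List (Fin (2 * N))) :
    cell N ρ (u ++ w) ⊆ cell N ρ w := by
  induction u with
  | nil => simp
  | cons r u ih => exact (cell_cons N hN ρ hρ r (u ++ w)).trans ih

lemma cell_diam (N : ℕ) (ρ : ℝ) (w : List (Fin (2 * N))) (x y : ℝ)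
    (hx : x ∈ cell N ρ w) (hy : y ∈ cell N ρ w) : |x - y| ≤ ρ / (4 * N : ℝ) ^ w.length := by
  have e : ρ * (wpos N w + 1) / (4 * N : ℝ) ^ w.length =
    ρ * wpos N w / (4 * N : ℝ) ^ w.length + ρ / (4 * N : ℝ) ^ w.length := by ring
  simp only [cell, e, mem_Icc] at hx hy
  rw [abs_le]
  constructor <;> linarith [hx.1, hx.2, hy.1, hy.2]

lemma wpos_even (N : ℕ) (w : List (Fin (2 * N))) : 2 ∣ wpos N w := by
  cases w with
  | nil => simp [wpos]
  | cons r w =>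
    simp only [wpos]
    exact ⟨2 * N * wpos N w + r.val, by ring⟩

lemma wpos_inj (N : ℕ) (v : List (Fin (2 * N))) : ∀ v' : List (Fin (2 * N)),
    v.length = v'.length → wpos N v = wpos N v' → v = v' := by
  induction v with
  | nil => intro v' h _; exact (List.length_eq_zero_iff.1 h.symm).symm
  | cons r v ih =>
    intro v' h hp
    cases v' with
    | nil => simp at h
    | cons r' v' =>
      simp only [wpos] at hp
      have hr := r.isLt
      have hr' := r'.isLt
      have e1 : (4 * N * wpos N v + 2 * r.val) % (4 * N) = 2 * r.val := by
        rw [Nat.mul_add_mod]; exact Nat.mod_eq_of_lt (by omega)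
      have e2 : (4 * N * wpos N v' + 2 * r'.val) % (4 * N) = 2 * r'.val := by
        rw [Nat.mul_add_mod]; exact Nat.mod_eq_of_lt (by omega)
      have e3 : 2 * r.val = 2 * r'.val := by rw [← e1, ← e2, hp]
      have e4 : 4 * N * wpos N v = 4 * N * wpos N v' := by omega
      have e5 : wpos N v = wpos N v' := Nat.eq_of_mul_eq_mul_left (by omega) e4
      rw [ih v' (by simpa using h) e5, Fin.ext (by omega : r.val = r'.val)]

lemma cell_sep (N : ℕ) (hN : 0 < N) (ρ : ℝ) (hρ : 0 < ρ) (v v' : List (Fin (2 * N)))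
    (hl : v.length = v'.length) (x y : ℝ) (hx : x ∈ cell N ρ v) (hy : y ∈ cell N ρ v')
    (hxy : |x - y| < ρ / (4 * N : ℝ) ^ v.length) : v = v' := by
  have key : ∀ (v v' : List (Fin (2 * N))) (x y : ℝ), v.length = v'.length →
      x ∈ cell N ρ v → y ∈ cell N ρ v' → |x - y| < ρ / (4 * N : ℝ) ^ v.length →
      ¬ wpos N v < wpos N v' := by
    intro v v' x y hl hx hy hxy hlt
    have h2 : wpos N v + 2 ≤ wpos N v' := by
      have := wpos_even N v
      have := wpos_even N v'
      omega
    have h2' : (wpos N v : ℝ) + 2 ≤ wpos N v' := by exact_mod_cast h2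
    have hN' : (0 : ℝ) < N := by exact_mod_cast hN
    have h3 : ρ * (wpos N v + 2) / (4 * N : ℝ) ^ v.length ≤
        ρ * wpos N v' / (4 * N : ℝ) ^ v.length := by gcongr
    have e : ρ * (wpos N v + 2) / (4 * N : ℝ) ^ v.length =
      ρ * (wpos N v + 1) / (4 * N : ℝ) ^ v.length + ρ / (4 * N : ℝ) ^ v.length := by ring
    have h4 := hx.2
    have h5 := hy.1
    rw [← hl] at h5
    have := (abs_lt.1 hxy).1
    linarith
  apply wpos_inj N v v' hl
  apply le_antisymm
  · exact not_lt.1 (key v' v y x hl.symm hy hx (by rw [abs_sub_comm, ← hl]; exact hxy))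
  · exact not_lt.1 (key v v' x y hl hx hy hxy)

lemma dim_of_inverse_holder (g : ℝ → ℝ) (C α : ℝ≥0) (hα : 0 < α)
    (h : ∀ z ∈ Ico (0 : ℝ) 1, ∀ z' ∈ Ico (0 : ℝ) 1,
      |z - z'| ≤ C * |g z - g z'| ^ (α : ℝ)) :
    (α : ℝ≥0∞) ≤ dimH (g '' Ico (0 : ℝ) 1) := by
  set s : Set ℝ := Ico (0 : ℝ) 1 with hs
  set f : ℝ → ℝ := Function.invFunOn g s with hf
  have hinj : InjOn g s := by
    intro z hz z' hz' e
    have := h z hz z' hz'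
    rw [e, sub_self, abs_zero, Real.zero_rpow (by exact_mod_cast hα.ne'), mul_zero] at this
    have := abs_nonpos_iff.1 this
    linarith
  have hfg : ∀ z ∈ s, f (g z) = z := fun z hz => hinj.leftInvOn_invFunOn hz
  have hH : HolderOnWith C α f (g '' s) := by
    rintro _ ⟨z, hz, rfl⟩ _ ⟨z', hz', rfl⟩
    rw [hfg z hz, hfg z' hz', edist_dist, edist_dist, Real.dist_eq, Real.dist_eq,
      ENNReal.ofReal_rpow_of_nonneg (abs_nonneg _) (by positivity), ← ENNReal.ofReal_coe_nnreal,
      ← ENNReal.ofReal_mul (by positivity)]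
    exact ENNReal.ofReal_le_ofReal (h z hz z' hz')
  have h1 := hH.dimH_image_le hα
  have h2 : f '' (g '' s) = s := by
    rw [image_image]
    ext y
    constructor
    · rintro ⟨z, hz, rfl⟩; simpa [hfg z hz] using hz
    · intro hy; exact ⟨y, hy, hfg y hy⟩
  rw [h2] at h1
  have h3 : dimH s = 1 := by
    have := Real.dimH_of_nonempty_interior (E := ℝ) (s := s) (by
      rw [hs, interior_Ico]; exact ⟨1/2, by norm_num, by norm_num⟩)
    simpa using this
  rw [h3] at h1
  have h0 : (α : ℝ≥0∞) ≠ 0 := by exact_mod_cast hα.ne'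
  rw [ENNReal.le_div_iff_mul_le (Or.inl h0) (Or.inl (by simp))] at h1
  simpa using h1

theorem cantor_dim (N : ℕ) (hN : 2 ≤ N) (ρ : ℝ) (hρ : 0 < ρ) (T : Set (List (Fin (2 * N))))
    (h0 : [] ∈ T)
    (hch : ∀ w ∈ T, ∃ f : Fin N → Fin (2 * N), Function.Injective f ∧ ∀ e, f e :: w ∈ T) :
    ENNReal.ofReal (Real.log N / Real.log (4 * N)) ≤
      dimH {x : ℝ | ∀ n : ℕ, ∃ w ∈ T, w.length = n ∧ x ∈ cell N ρ w} := by
  classical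
  have hN0 : 0 < N := by omega
  have hNR : (0 : ℝ) < N := by exact_mod_cast hN0
  have hN2 : (2 : ℝ) ≤ N := by exact_mod_cast hN
  have hch' : ∀ w : List (Fin (2 * N)), ∃ f : Fin N → Fin (2 * N),
      Function.Injective f ∧ (w ∈ T → ∀ e, f e :: w ∈ T) := by
    intro w
    by_cases hw : w ∈ T
    · obtain ⟨f, hf, hf'⟩ := hch w hw
      exact ⟨f, hf, fun _ => hf'⟩
    · exact ⟨fun e => ⟨e.val, by omega⟩, fun a b hab => by
        simpa [Fin.ext_iff] using hab, fun h => absurd h hw⟩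
  choose child cinj cmem using hch'
  let dig : ℕ → ℝ → Fin N := fun n z => ⟨⌊(N : ℝ) ^ (n + 1) * z⌋₊ % N, Nat.mod_lt _ hN0⟩
  let word : ℝ → ℕ → List (Fin (2 * N)) := fun z n =>
    Nat.rec [] (fun n w => child w (dig n z) :: w) n
  have word_succ : ∀ z n, word z (n + 1) = child (word z n) (dig n z) :: word z n :=
    fun z n => rfl
  have word_zero : ∀ z, word z 0 = [] := fun z => rfl
  have word_len : ∀ z n, (word z n).length = n := by
    intro z n
    induction n with
    | zero => simp [word_zero]
    | succ n ih => simp [word_succ, ih]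
  have word_mem : ∀ z n, word z n ∈ T := by
    intro z n
    induction n with
    | zero => simpa [word_zero] using h0
    | succ n ih => rw [word_succ]; exact cmem _ ih _
  have word_floor : ∀ z ∈ Ico (0 : ℝ) 1, ∀ z' ∈ Ico (0 : ℝ) 1, ∀ n, word z n = word z' n →
      ⌊(N : ℝ) ^ n * z⌋₊ = ⌊(N : ℝ) ^ n * z'⌋₊ := by
    intro z hz z' hz' n
    induction n with
    | zero =>
      intro _
      rw [Nat.floor_eq_zero.2 (by simpa using hz.2), Nat.floor_eq_zero.2 (by simpa using hz'.2)]
    | succ n ih =>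
      intro h
      rw [word_succ, word_succ, List.cons.injEq] at h
      have h1 := ih h.2
      have h2 : dig n z = dig n z' := by
        have := h.1
        rw [h.2] at this
        exact cinj _ this
      have h3 : ⌊(N : ℝ) ^ (n + 1) * z⌋₊ % N = ⌊(N : ℝ) ^ (n + 1) * z'⌋₊ % N := by
        simpa [dig, Fin.ext_iff] using h2
      have hdiv : ∀ y : ℝ, ⌊(N : ℝ) ^ (n + 1) * y⌋₊ / N = ⌊(N : ℝ) ^ n * y⌋₊ := by
        intro y
        rw [← Nat.floor_div_natCast]
        congr 1
        field_simp
        try ring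
      rw [← Nat.div_add_mod ⌊(N : ℝ) ^ (n + 1) * z⌋₊ N,
        ← Nat.div_add_mod ⌊(N : ℝ) ^ (n + 1) * z'⌋₊ N, hdiv, hdiv, h1, h3]
  -- the points
  have hpt : ∀ z, ∃ x, ∀ n, x ∈ cell N ρ (word z n) := by
    intro z
    have := IsCompact.nonempty_iInter_of_sequence_nonempty_isCompact_isClosed
      (fun n => cell N ρ (word z n))
      (fun n => by rw [word_succ]; exact cell_cons N hN0 ρ hρ _ _)
      (fun n => by
        apply nonempty_Icc.2
        gcongr
        linarith)
      isCompact_Icc (fun n => isClosed_Icc)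
    obtain ⟨x, hx⟩ := this
    exact ⟨x, fun n => mem_iInter.1 hx n⟩
  choose g hg using hpt
  set α : ℝ := Real.log N / Real.log (4 * N) with hα
  have hlogN : 0 < Real.log N := Real.log_pos (by linarith)
  have hlog4 : 0 < Real.log (4 * N) := Real.log_pos (by linarith)
  have hα0 : 0 < α := div_pos hlogN hlog4
  have hpow : (4 * N : ℝ) ^ α = N := by
    rw [Real.rpow_def_of_pos (by positivity), hα, mul_div_cancel₀ _ hlog4.ne', Real.exp_log hNR]
  set C : ℝ := (4 * N / ρ) ^ α with hC
  have hCpos : 0 ≤ C := by positivity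
  have main : ∀ z ∈ Ico (0 : ℝ) 1, ∀ z' ∈ Ico (0 : ℝ) 1, |z - z'| ≤ C * |g z - g z'| ^ α := by
    intro z hz z' hz'
    rcases Classical.em (∃ n, word z n ≠ word z' n) with hex | hex
    · obtain ⟨m, hm', hn⟩ : ∃ m, word z m = word z' m ∧ word z (m + 1) ≠ word z' (m + 1) := by
        by_contra hcon
        push Not at hcon
        obtain ⟨n, hn⟩ := hex
        apply hn
        clear hn
        induction n with
        | zero => rfl
        | succ n ih => exact hcon n ih
      have h1 := word_floor z hz z' hz' m hm'
      have h2 : |z - z'| ≤ 1 / (N : ℝ) ^ m := by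
        rw [le_div_iff₀ (by positivity)]
        have a1 := Nat.floor_le (a := (N : ℝ) ^ m * z) (by have := hz.1; positivity)
        have a2 := Nat.floor_le (a := (N : ℝ) ^ m * z') (by have := hz'.1; positivity)
        have a3 := Nat.lt_floor_add_one ((N : ℝ) ^ m * z)
        have a4 := Nat.lt_floor_add_one ((N : ℝ) ^ m * z')
        rw [h1] at a1 a3
        have : |(N : ℝ) ^ m * z - (N : ℝ) ^ m * z'| ≤ 1 := by
          rw [abs_le]; constructor <;> linarith
        rw [← mul_sub, abs_mul, abs_of_pos (by positivity : (0 : ℝ) < (N : ℝ) ^ m)] at this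
        linarith
      have h3 : ρ / (4 * N : ℝ) ^ (m + 1) ≤ |g z - g z'| := by
        by_contra hlt
        push Not at hlt
        exact hn (cell_sep N hN0 ρ hρ _ _ (by simp [word_len]) _ _ (hg z (m + 1))
          (hg z' (m + 1)) (lt_of_lt_of_eq hlt (by rw [show (word z (m + 1)).length = m + 1 from word_len z (m + 1)])))
      calc |z - z'| ≤ 1 / (N : ℝ) ^ m := h2
        _ = C * (ρ / (4 * N : ℝ) ^ (m + 1)) ^ α := by
          rw [hC, ← Real.mul_rpow (by positivity) (by positivity)]
          have : 4 * N / ρ * (ρ / (4 * N : ℝ) ^ (m + 1)) = ((4 * N : ℝ) ^ m)⁻¹ := by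
            rw [pow_succ]
            field_simp
          have h4 : ((4 * N : ℝ) ^ m) ^ α = (N : ℝ) ^ m := by
            rw [← Real.rpow_natCast, ← Real.rpow_mul (by positivity), mul_comm (m : ℝ) α,
              Real.rpow_mul (by positivity), hpow, Real.rpow_natCast]
          rw [this, Real.inv_rpow (by positivity), h4, one_div]
        _ ≤ _ := by gcongr
    · push Not at hex
      have hz1 : ∀ n : ℕ, |z - z'| * (N : ℝ) ^ n ≤ 1 := by
        intro n
        have h1 := word_floor z hz z' hz' n (hex n)
        have a1 := Nat.floor_le (a := (N : ℝ) ^ n * z) (by have := hz.1; positivity)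
        have a2 := Nat.floor_le (a := (N : ℝ) ^ n * z') (by have := hz'.1; positivity)
        have a3 := Nat.lt_floor_add_one ((N : ℝ) ^ n * z)
        have a4 := Nat.lt_floor_add_one ((N : ℝ) ^ n * z')
        rw [h1] at a1 a3
        have : |(N : ℝ) ^ n * z - (N : ℝ) ^ n * z'| ≤ 1 := by
          rw [abs_le]; constructor <;> linarith
        rw [← mul_sub, abs_mul, abs_of_pos (by positivity : (0 : ℝ) < (N : ℝ) ^ n)] at this
        linarith
      have : |z - z'| ≤ 0 := by
        by_contra hpos
        push Not at hpos
        obtain ⟨n, hn⟩ := pow_unbounded_of_one_lt (1 / |z - z'|) (by linarith : (1 : ℝ) < N)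
        rw [div_lt_iff₀ hpos] at hn
        have := hz1 n
        linarith
      exact this.trans (by positivity)
  have := dim_of_inverse_holder g ⟨C, hCpos⟩ ⟨α, hα0.le⟩ (by exact_mod_cast hα0) main
  refine le_trans ?_ (this.trans (dimH_mono ?_))
  · rw [ENNReal.ofReal_eq_coe_nnreal hα0.le]
    exact le_rfl
  · rintro _ ⟨z, hz, rfl⟩ n
    exact ⟨word z n, word_mem z n, word_len z n, hg z n⟩

end Cells


section Arith

/-- a dangerous rational point with a line through it, and a point of its interval -/
structure Dat (i j β c : ℝ) (q : ℕ) (p m A B C : ℤ) (x : ℝ) : Prop where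
  q0 : 0 < q
  hm : |(q : ℝ) * β - m| ≤ c / (q : ℝ) ^ j
  hp : |(q : ℝ) * x - p| ≤ c / (q : ℝ) ^ i
  A0 : A ≠ 0
  hA : |(A : ℝ)| ≤ (q : ℝ) ^ i
  hB : |(B : ℝ)| ≤ (q : ℝ) ^ j
  line : A * p + B * m + C * q = 0

lemma rpow_le_scale (a b l e : ℝ) (ha : 0 ≤ a) (hb : 0 ≤ b) (hl : 1 ≤ l) (he : 0 ≤ e)
    (he1 : e ≤ 1) (h : a ≤ l * b) : a ^ e ≤ l * b ^ e := by
  calc a ^ e ≤ (l * b) ^ e := Real.rpow_le_rpow ha h he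
    _ = l ^ e * b ^ e := Real.mul_rpow (by linarith) hb
    _ ≤ l * b ^ e := by
      gcongr
      calc l ^ e ≤ l ^ (1 : ℝ) := Real.rpow_le_rpow_of_exponent_le hl he1
        _ = l := Real.rpow_one l

lemma ratio_q (q1 q2 l i : ℝ) (h1 : 0 < q1) (h2 : 0 < q2) (hl : 1 ≤ l) (hi : 0 ≤ i)
    (h : q1 ^ i * q1 ≤ l * (q2 ^ i * q2)) : q1 ≤ l * q2 := by
  by_contra hlt
  push Not at hlt
  have h3 : q2 ≤ q1 := by nlinarith
  have h4 : q2 ^ i ≤ q1 ^ i := Real.rpow_le_rpow h2.le h3 hi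
  have h5 : 0 < q2 ^ i := Real.rpow_pos_of_pos h2 i
  nlinarith [mul_lt_mul_of_pos_left hlt h5, mul_le_mul_of_nonneg_right h4 h1.le]

lemma minkowski (i j : ℝ) (hij : i + j = 1) (q : ℕ) (hq : 0 < q) (p m : ℤ) :
    ∃ A B C : ℤ, (A ≠ 0 ∨ B ≠ 0) ∧ |(A : ℝ)| ≤ (q : ℝ) ^ i ∧ |(B : ℝ)| ≤ (q : ℝ) ^ j ∧
      A * p + B * m + C * q = 0 := by
  have hqR : (0 : ℝ) < q := by exact_mod_cast hq
  set X : ℝ := (q : ℝ) ^ i with hX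
  set Y : ℝ := (q : ℝ) ^ j with hY
  have hX0 : 0 < X := Real.rpow_pos_of_pos hqR i
  have hY0 : 0 < Y := Real.rpow_pos_of_pos hqR j
  have hXY : X * Y = q := by
    rw [hX, hY, ← Real.rpow_add hqR, hij, Real.rpow_one]
  let S := Finset.range (⌊X⌋₊ + 1) ×ˢ Finset.range (⌊Y⌋₊ + 1)
  let Tt := Finset.Ico (0 : ℤ) q
  have hcard : Tt.card < S.card := by
    simp only [Tt, S, Finset.card_product, Finset.card_range, Int.card_Ico, sub_zero,
      Int.toNat_natCast]
    have h1 := Nat.lt_floor_add_one X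
    have h2 := Nat.lt_floor_add_one Y
    have : (q : ℝ) < ((⌊X⌋₊ + 1) * (⌊Y⌋₊ + 1) : ℕ) := by
      rw [← hXY]
      push_cast
      exact mul_lt_mul'' h1 h2 hX0.le hY0.le
    exact_mod_cast this
  have hqZ : (0 : ℤ) < q := by exact_mod_cast hq
  obtain ⟨⟨a, b⟩, hab, ⟨a', b'⟩, hab', hne, heq⟩ :=
    Finset.exists_ne_map_eq_of_card_lt_of_maps_to (f := fun s : ℕ × ℕ =>
      ((s.1 : ℤ) * p + (s.2 : ℤ) * m) % (q : ℤ)) hcard (by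
        intro s _
        simp only [Tt, Finset.coe_Ico, mem_Ico]
        exact ⟨Int.emod_nonneg _ hqZ.ne', Int.emod_lt_of_pos _ hqZ⟩)
  simp only [S, Finset.mem_product, Finset.mem_range] at hab hab'
  simp only at heq
  have hdvd := Int.ModEq.dvd (show ((a : ℤ) * p + (b : ℤ) * m) ≡ ((a' : ℤ) * p + (b' : ℤ) * m)
    [ZMOD q] from heq)
  obtain ⟨C, hC⟩ := hdvd
  have bound : ∀ (Z : ℝ) (a a' : ℕ), 0 < Z → a < ⌊Z⌋₊ + 1 → a' < ⌊Z⌋₊ + 1 →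
      |(((a' : ℤ) - a : ℤ) : ℝ)| ≤ Z := by
    intro Z a a' hZ h h'
    have h1 : (a : ℝ) ≤ Z := le_trans (by exact_mod_cast Nat.lt_succ_iff.1 h) (Nat.floor_le hZ.le)
    have h2 : (a' : ℝ) ≤ Z := le_trans (by exact_mod_cast Nat.lt_succ_iff.1 h') (Nat.floor_le hZ.le)
    have h3 : (0 : ℝ) ≤ a := by positivity
    have h4 : (0 : ℝ) ≤ a' := by positivity
    push_cast
    rw [abs_le]; constructor <;> linarith
  refine ⟨(a' : ℤ) - a, (b' : ℤ) - b, -C, ?_, bound X a a' hX0 hab.1 hab'.1,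
    bound Y b b' hY0 hab.2 hab'.2, by linarith⟩
  by_contra hcon
  push Not at hcon
  apply hne
  ext <;> simp <;> omega

lemma exists_line (i j β c κ : ℝ) (hj : 0 < j) (hij : i + j = 1) (hcκ : c < κ)
    (hc : 0 < c)
    (hβ : ∀ (n : ℕ) (C : ℤ), 0 < n → κ ≤ (n : ℝ) ^ (1 / j) * |(n : ℝ) * β + C|)
    (q : ℕ) (hq : 0 < q) (p m : ℤ) (x : ℝ) (hm : |(q : ℝ) * β - m| ≤ c / (q : ℝ) ^ j)
    (hp : |(q : ℝ) * x - p| ≤ c / (q : ℝ) ^ i) : ∃ A B C : ℤ, Dat i j β c q p m A B C x := by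
  obtain ⟨A, B, C, hne, hA, hB, hl⟩ := minkowski i j hij q hq p m
  refine ⟨A, B, C, hq, hm, hp, ?_, hA, hB, hl⟩
  rintro rfl
  have hB0 : B ≠ 0 := by simpa using hne
  have hqR : (0 : ℝ) < q := by exact_mod_cast hq
  set Y : ℝ := (q : ℝ) ^ j with hY
  have hY0 : 0 < Y := Real.rpow_pos_of_pos hqR j
  -- choose sign
  have key : ∀ C' : ℤ, |((B.natAbs : ℕ) : ℝ) * β + C'| = |(B : ℝ) * β + C| → False := by
    intro C' hC'
    have h1 := hβ B.natAbs C' (Int.natAbs_pos.2 hB0)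
    rw [hC'] at h1
    have h2 : ((B.natAbs : ℕ) : ℝ) = |(B : ℝ)| := by
      rw [Nat.cast_natAbs, Int.cast_abs]
    rw [h2] at h1
    have h3 : |(B : ℝ)| ^ (1 / j) ≤ q := by
      calc |(B : ℝ)| ^ (1 / j) ≤ Y ^ (1 / j) :=
            Real.rpow_le_rpow (abs_nonneg _) hB (by positivity)
        _ = q := by rw [hY, ← Real.rpow_mul hqR.le, mul_one_div_cancel hj.ne', Real.rpow_one]
    have hl' : (B : ℝ) * m + C * q = 0 := by
      have : (0 : ℤ) * p + B * m + C * q = 0 := hl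
      have h := congrArg (fun z : ℤ => (z : ℝ)) this
      push_cast at h
      linarith
    have h4 : (q : ℝ) * |(B : ℝ) * β + C| ≤ c := by
      have e : (q : ℝ) * ((B : ℝ) * β + C) = B * (q * β - m) := by linear_combination hl'
      calc (q : ℝ) * |(B : ℝ) * β + C| = |(q : ℝ) * ((B : ℝ) * β + C)| := by
            rw [abs_mul, abs_of_pos hqR]
        _ = |(B : ℝ)| * |q * β - m| := by rw [e, abs_mul]
        _ ≤ Y * (c / Y) := by gcongr
        _ = c := by field_simp
    have h5 : |(B : ℝ)| ^ (1 / j) * |(B : ℝ) * β + C| ≤ q * |(B : ℝ) * β + C| := by gcongr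
    linarith
  rcases le_total 0 B with hs | hs
  · apply key C
    rw [Nat.cast_natAbs, abs_of_nonneg hs]
  · apply key (-C)
    rw [Nat.cast_natAbs, abs_of_nonpos hs, ← abs_neg]
    congr 1
    push_cast
    ring

lemma eq_zero_of_abs_lt (n : ℤ) (h : |(n : ℝ)| < 1) : n = 0 := by
  have : |n| < 1 := by exact_mod_cast h
  exact Int.abs_lt_one_iff.1 this

/-- two points of the same class in a short interval are close -/
lemma typeA_core (i j β c l d : ℝ) (hc : 0 < c) (hl : 1 ≤ l)
    (q1 q2 : ℕ) (p1 m1 A1 B1 C1 p2 m2 A2 B2 C2 : ℤ) (x1 x2 : ℝ)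
    (D1 : Dat i j β c q1 p1 m1 A1 B1 C1 x1) (D2 : Dat i j β c q2 p2 m2 A2 B2 C2 x2)
    (hX : (q1 : ℝ) ^ i ≤ l * (q2 : ℝ) ^ i) (hY : (q1 : ℝ) ^ j ≤ l * (q2 : ℝ) ^ j)
    (hq : (q2 : ℝ) ≤ l * q1) (hq' : (q1 : ℝ) ≤ l * q2)
    (hd : |x1 - x2| ≤ d) (hAd : |(A1 : ℝ)| * q2 * d ≤ 1 / 2) (hcl : c * l < 1 / 8) :
    |(A1 : ℝ)| * q1 * |x1 - x2| ≤ 4 * c * l ^ 2 := by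
  have hq1 : (0 : ℝ) < q1 := by exact_mod_cast D1.q0
  have hq2 : (0 : ℝ) < q2 := by exact_mod_cast D2.q0
  set X1 := (q1 : ℝ) ^ i
  set X2 := (q2 : ℝ) ^ i
  set Y1 := (q1 : ℝ) ^ j
  set Y2 := (q2 : ℝ) ^ j
  have hX1 : 0 < X1 := Real.rpow_pos_of_pos hq1 i
  have hX2 : 0 < X2 := Real.rpow_pos_of_pos hq2 i
  have hY1 : 0 < Y1 := Real.rpow_pos_of_pos hq1 j
  have hY2 : 0 < Y2 := Real.rpow_pos_of_pos hq2 j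
  have hl0 : 0 < l := by linarith
  have l1 : (A1 : ℝ) * p1 + B1 * m1 + C1 * q1 = 0 := by exact_mod_cast D1.line
  -- basic products
  have a1 : |(A1 : ℝ)| * |(q1 : ℝ) * x1 - p1| ≤ c := by
    calc _ ≤ X1 * (c / X1) := by gcongr; exacts [D1.hA, D1.hp]
      _ = c := by field_simp
  have a2 : |(B1 : ℝ)| * |(q1 : ℝ) * β - m1| ≤ c := by
    calc _ ≤ Y1 * (c / Y1) := by gcongr; exacts [D1.hB, D1.hm]
      _ = c := by field_simp
  have a3 : |(A1 : ℝ)| * |(q2 : ℝ) * x2 - p2| ≤ c * l := by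
    calc _ ≤ (l * X2) * (c / X2) := by gcongr; exacts [D1.hA.trans hX, D2.hp]
      _ = c * l := by field_simp
  have a4 : |(B1 : ℝ)| * |(q2 : ℝ) * β - m2| ≤ c * l := by
    calc _ ≤ (l * Y2) * (c / Y2) := by gcongr; exacts [D1.hB.trans hY, D2.hm]
      _ = c * l := by field_simp
  -- f1 at x1
  have f1 : (q1 : ℝ) * |A1 * x1 + B1 * β + C1| ≤ 2 * c := by
    have e : (q1 : ℝ) * (A1 * x1 + B1 * β + C1) = A1 * (q1 * x1 - p1) + B1 * (q1 * β - m1) := by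
      linear_combination l1
    calc (q1 : ℝ) * |A1 * x1 + B1 * β + C1| = |(q1 : ℝ) * (A1 * x1 + B1 * β + C1)| := by
          rw [abs_mul, abs_of_pos hq1]
      _ ≤ |(A1 : ℝ)| * |q1 * x1 - p1| + |(B1 : ℝ)| * |q1 * β - m1| := by
          rw [e, ← abs_mul, ← abs_mul]; exact abs_add_le _ _
      _ ≤ 2 * c := by linarith
  -- the integer vanishes
  have hN : A1 * p2 + B1 * m2 + C1 * q2 = 0 := by
    apply eq_zero_of_abs_lt
    have e : ((A1 * p2 + B1 * m2 + C1 * q2 : ℤ) : ℝ) =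
        q2 * (A1 * x1 + B1 * β + C1) + A1 * q2 * (x2 - x1) - A1 * (q2 * x2 - p2)
          - B1 * (q2 * β - m2) := by push_cast; ring
    rw [e]
    have t1 : |(q2 : ℝ) * (A1 * x1 + B1 * β + C1)| ≤ 2 * c * l := by
      rw [abs_mul, abs_of_pos hq2]
      calc (q2 : ℝ) * |A1 * x1 + B1 * β + C1| ≤ (l * q1) * |A1 * x1 + B1 * β + C1| := by gcongr
        _ = l * (q1 * |A1 * x1 + B1 * β + C1|) := by ring
        _ ≤ l * (2 * c) := by gcongr
        _ = _ := by ring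
    have t2 : |(A1 : ℝ) * q2 * (x2 - x1)| ≤ 1 / 2 := by
      rw [abs_mul, abs_mul, abs_of_pos hq2, abs_sub_comm]
      exact le_trans (by gcongr) hAd
    have t3 : |(A1 : ℝ) * (q2 * x2 - p2)| ≤ c * l := by rw [abs_mul]; exact a3
    have t4 : |(B1 : ℝ) * (q2 * β - m2)| ≤ c * l := by rw [abs_mul]; exact a4
    rw [abs_le] at t1 t2 t3 t4
    rw [abs_lt]
    constructor <;> linarith [t1.1, t1.2, t2.1, t2.2, t3.1, t3.2, t4.1, t4.2]
  have l2 : (A1 : ℝ) * p2 + B1 * m2 + C1 * q2 = 0 := by exact_mod_cast hN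
  have f2 : (q2 : ℝ) * |A1 * x2 + B1 * β + C1| ≤ 2 * (c * l) := by
    have e : (q2 : ℝ) * (A1 * x2 + B1 * β + C1) = A1 * (q2 * x2 - p2) + B1 * (q2 * β - m2) := by
      linear_combination l2
    calc (q2 : ℝ) * |A1 * x2 + B1 * β + C1| = |(q2 : ℝ) * (A1 * x2 + B1 * β + C1)| := by
          rw [abs_mul, abs_of_pos hq2]
      _ ≤ |(A1 : ℝ)| * |q2 * x2 - p2| + |(B1 : ℝ)| * |q2 * β - m2| := by
          rw [e, ← abs_mul, ← abs_mul]; exact abs_add_le _ _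
      _ ≤ 2 * (c * l) := by linarith
  have f2' : (q1 : ℝ) * |A1 * x2 + B1 * β + C1| ≤ 2 * c * l ^ 2 := by
    calc (q1 : ℝ) * |A1 * x2 + B1 * β + C1| ≤ (l * q2) * |A1 * x2 + B1 * β + C1| := by gcongr
      _ = l * (q2 * |A1 * x2 + B1 * β + C1|) := by ring
      _ ≤ l * (2 * (c * l)) := by gcongr
      _ = _ := by ring
  have e : (A1 : ℝ) * (x1 - x2) = (A1 * x1 + B1 * β + C1) - (A1 * x2 + B1 * β + C1) := by ring
  have hl2 : 1 ≤ l ^ 2 := by nlinarith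
  calc |(A1 : ℝ)| * q1 * |x1 - x2| = q1 * |(A1 : ℝ) * (x1 - x2)| := by rw [abs_mul]; ring
    _ ≤ q1 * (|A1 * x1 + B1 * β + C1| + |A1 * x2 + B1 * β + C1|) := by
        rw [e]; gcongr; exact abs_sub _ _
    _ = q1 * |A1 * x1 + B1 * β + C1| + q1 * |A1 * x2 + B1 * β + C1| := by ring
    _ ≤ 2 * c + 2 * c * l ^ 2 := by linarith
    _ ≤ 4 * c * l ^ 2 := by nlinarith

end Arith


section Classes

/-- homogeneous class -/
def ClassH (i j β b : ℝ) (n k : ℕ) (x : ℝ) : Prop :=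
  ∃ (q : ℕ) (p m A B C : ℤ), Dat i j β (1 / b ^ 20) q p m A B C x ∧
    b ^ n ≤ |(A : ℝ)| * q ∧ |(A : ℝ)| * q < b ^ (n + 1) ∧
    b ^ (4 * k) * |(A : ℝ)| ≤ (q : ℝ) ^ i ∧ (q : ℝ) ^ i < b ^ (4 * (k + 1)) * |(A : ℝ)|

/-- inhomogeneous class -/
def ClassI (i j β γ η b : ℝ) (n : ℕ) (x : ℝ) : Prop :=
  ∃ (q : ℕ) (p m : ℤ), 0 < q ∧ |(q : ℝ) * x - γ - p| ≤ 1 / b ^ 30 / (q : ℝ) ^ i ∧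
    |(q : ℝ) * β - η - m| ≤ 1 / b ^ 30 / (q : ℝ) ^ j ∧
    b ^ n ≤ (q : ℝ) ^ i * q * b ^ 20 ∧ (q : ℝ) ^ i * q * b ^ 20 < b ^ (n + 1)

/-- weak goodness of a point at a level -/
def WGood (i j β b : ℝ) (n : ℕ) (x : ℝ) : Prop :=
  ∀ (Q : ℕ) (p m : ℤ), 0 < Q → |(Q : ℝ) * β - m| ≤ 1 / b ^ 20 / (Q : ℝ) ^ j →
    |(Q : ℝ) * x - p| ≤ 1 / b ^ 20 / (Q : ℝ) ^ i → b ^ n ≤ (Q : ℝ) ^ i * Q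

/-- comparability inside a homogeneous class -/
lemma class_ratio (i b : ℝ) (hi : 0 ≤ i) (hb : 8 ≤ b) (n k : ℕ) (q1 q2 a1 a2 : ℝ)
    (h1 : 0 < q1) (h2 : 0 < q2) (ha1 : 0 < a1)
    (h3 : a1 * q1 < b ^ (n + 1)) (h4 : q1 ^ i < b ^ (4 * (k + 1)) * a1)
    (h5 : b ^ n ≤ a2 * q2) (h6 : b ^ (4 * k) * a2 ≤ q2 ^ i) :
    q1 ^ i * q1 ≤ b ^ 5 * b ^ (4 * k) * b ^ n ∧ q1 ≤ b ^ 5 * q2 := by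
  have hb0 : 0 < b := by linarith
  have e1 : q1 ^ i * q1 ≤ b ^ 5 * b ^ (4 * k) * b ^ n := by
    calc q1 ^ i * q1 ≤ (b ^ (4 * (k + 1)) * a1) * q1 := by gcongr
      _ = b ^ (4 * (k + 1)) * (a1 * q1) := by ring
      _ ≤ b ^ (4 * (k + 1)) * b ^ (n + 1) := by gcongr
      _ = _ := by ring
  refine ⟨e1, ratio_q q1 q2 (b ^ 5) i h1 h2 (one_le_pow₀ (by linarith)) hi (e1.trans ?_)⟩
  rw [mul_assoc]
  refine mul_le_mul_of_nonneg_left ?_ (by positivity)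
  calc b ^ (4 * k) * b ^ n ≤ b ^ (4 * k) * (a2 * q2) := by gcongr
    _ = (b ^ (4 * k) * a2) * q2 := by ring
    _ ≤ _ := by gcongr

lemma typeA (i j β b : ℝ) (hi : 0 ≤ i) (hi1 : i ≤ 1) (hj : 0 ≤ j) (hj1 : j ≤ 1) (hb : 8 ≤ b)
    (n k : ℕ) (x1 x2 : ℝ) (H1 : ClassH i j β b n k x1) (H2 : ClassH i j β b n k x2)
    (hd : |x1 - x2| ≤ 1 / b ^ 7 / b ^ n) : |x1 - x2| < 1 / b ^ 7 / b ^ (n + 1) := by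
  obtain ⟨q1, p1, m1, A1, B1, C1, D1, a1, a2, a3, a4⟩ := H1
  obtain ⟨q2, p2, m2, A2, B2, C2, D2, b1, b2, b3, b4⟩ := H2
  have hb0 : 0 < b := by linarith
  have hq1 : (0 : ℝ) < q1 := by exact_mod_cast D1.q0
  have hq2 : (0 : ℝ) < q2 := by exact_mod_cast D2.q0
  have hA1 : 0 < |(A1 : ℝ)| := abs_pos.2 (by exact_mod_cast D1.A0)
  have hA2 : 0 < |(A2 : ℝ)| := abs_pos.2 (by exact_mod_cast D2.A0)
  have hl : 1 ≤ b ^ 5 := one_le_pow₀ (by linarith)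
  obtain ⟨-, r12⟩ := class_ratio i b hi hb n k q1 q2 _ _ hq1 hq2 hA1 a2 a4 b1 b3
  obtain ⟨-, r21⟩ := class_ratio i b hi hb n k q2 q1 _ _ hq2 hq1 hA2 b2 b4 a1 a3
  have hX := rpow_le_scale _ _ _ i hq1.le hq2.le hl hi hi1 r12
  have hY := rpow_le_scale _ _ _ j hq1.le hq2.le hl hj hj1 r12
  have key := typeA_core i j β (1 / b ^ 20) (b ^ 5) (1 / b ^ 7 / b ^ n) (by positivity) hl
    q1 q2 p1 m1 A1 B1 C1 p2 m2 A2 B2 C2 x1 x2 D1 D2 hX hY r21 r12 hd ?_ ?_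
  · have h1 : b ^ n * |x1 - x2| ≤ 4 * (1 / b ^ 20) * (b ^ 5) ^ 2 :=
      le_trans (by gcongr) key
    rw [lt_div_iff₀ (by positivity)]
    calc |x1 - x2| * b ^ (n + 1) = b * (b ^ n * |x1 - x2|) := by ring
      _ ≤ b * (4 * (1 / b ^ 20) * (b ^ 5) ^ 2) := by gcongr
      _ = (4 / b ^ 2) / b ^ 7 := by field_simp
      _ < 1 / b ^ 7 := by
        gcongr
        rw [div_lt_one (by positivity)]
        nlinarith
  · calc |(A1 : ℝ)| * q2 * (1 / b ^ 7 / b ^ n)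
        ≤ |(A1 : ℝ)| * (b ^ 5 * q1) * (1 / b ^ 7 / b ^ n) := by gcongr
      _ = b ^ 5 * (1 / b ^ 7 / b ^ n) * (|(A1 : ℝ)| * q1) := by ring
      _ ≤ b ^ 5 * (1 / b ^ 7 / b ^ n) * b ^ (n + 1) := by gcongr
      _ = 1 / b := by field_simp; ring
      _ ≤ 1 / 2 := by gcongr; linarith
  · have : 1 / b ^ 20 * b ^ 5 = 1 / b ^ 15 := by field_simp
    rw [this]
    apply one_div_lt_one_div_of_lt (by norm_num)
    calc (8 : ℝ) ≤ b := hb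
      _ = b ^ 1 := (pow_one b).symm
      _ < b ^ 15 := by gcongr <;> linarith

set_option maxHeartbeats 1600000 in
lemma typeC (i j β γ η b : ℝ) (hi : 0 ≤ i) (hi1 : i ≤ 1) (hj : 0 ≤ j) (hj1 : j ≤ 1) (hb : 8 ≤ b)
    (n : ℕ) (x1 x2 : ℝ) (H1 : ClassI i j β γ η b n x1) (H2 : ClassI i j β γ η b n x2)
    (hW1 : WGood i j β b n x1)
    (hd : |x1 - x2| ≤ 1 / b ^ 7 / b ^ n) : |x1 - x2| < 1 / b ^ 7 / b ^ (n + 1) := by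
  obtain ⟨q1, p1, m1, q10, a1, a2, a3, a4⟩ := H1
  obtain ⟨q2, p2, m2, q20, b1, b2, b3, b4⟩ := H2
  have hb0 : 0 < b := by linarith
  have hb1 : 1 ≤ b := by linarith
  have hq1 : (0 : ℝ) < q1 := by exact_mod_cast q10
  have hq2 : (0 : ℝ) < q2 := by exact_mod_cast q20
  have hX1 : 0 < (q1 : ℝ) ^ i := Real.rpow_pos_of_pos hq1 i
  have hX2 : 0 < (q2 : ℝ) ^ i := Real.rpow_pos_of_pos hq2 i
  have hY1 : 0 < (q1 : ℝ) ^ j := Real.rpow_pos_of_pos hq1 j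
  have hY2 : 0 < (q2 : ℝ) ^ j := Real.rpow_pos_of_pos hq2 j
  have ratio : ∀ q q' : ℝ, 0 < q → 0 < q' → q ^ i * q * b ^ 20 < b ^ (n + 1) →
      b ^ n ≤ q' ^ i * q' * b ^ 20 → q ≤ b * q' := by
    intro q q' hq hq' h h'
    apply ratio_q q q' b i hq hq' hb1 hi
    have h20 : 0 < b ^ 20 := by positivity
    have : q ^ i * q * b ^ 20 ≤ (b * (q' ^ i * q')) * b ^ 20 := by
      calc _ ≤ b ^ (n + 1) := h.le
        _ = b * b ^ n := by ring
        _ ≤ b * (q' ^ i * q' * b ^ 20) := by gcongr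
        _ = _ := by ring
    exact le_of_mul_le_mul_right this h20
  have r12 := ratio q1 q2 hq1 hq2 a4 b3
  have r21 := ratio q2 q1 hq2 hq1 b4 a3
  -- generic bounds for Q ≤ max
  have hQb : ∀ Q e : ℝ, 0 ≤ Q → 0 ≤ e → e ≤ 1 → (Q ≤ q1 ∨ Q ≤ q2) →
      Q ^ e ≤ b * (q1 : ℝ) ^ e ∧ Q ^ e ≤ b * (q2 : ℝ) ^ e := by
    intro Q e hQ he he1 h
    constructor
    · apply rpow_le_scale _ _ _ _ hQ hq1.le hb1 he he1
      rcases h with h | h <;> nlinarith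
    · apply rpow_le_scale _ _ _ _ hQ hq2.le hb1 he he1
      rcases h with h | h <;> nlinarith
  have hu : (q2 : ℝ) * |x1 - x2| ≤ 1 / b ^ 26 / (q2 : ℝ) ^ i := by
    rw [le_div_iff₀ hX2]
    calc (q2 : ℝ) * |x1 - x2| * (q2 : ℝ) ^ i
        ≤ (q2 : ℝ) * (1 / b ^ 7 / b ^ n) * (q2 : ℝ) ^ i := by gcongr
      _ = ((q2 : ℝ) ^ i * q2 * b ^ 20) * (1 / b ^ 27 / b ^ n) := by field_simp
      _ ≤ b ^ (n + 1) * (1 / b ^ 27 / b ^ n) := by gcongr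
      _ = 1 / b ^ 26 := by rw [pow_succ]; field_simp
  have hx : |((q1 : ℝ) - q2) * x1 - ((p1 : ℝ) - p2)| ≤
      1 / b ^ 30 / (q1 : ℝ) ^ i + 1 / b ^ 30 / (q2 : ℝ) ^ i + 1 / b ^ 26 / (q2 : ℝ) ^ i := by
    have e : ((q1 : ℝ) - q2) * x1 - ((p1 : ℝ) - p2) =
      (q1 * x1 - γ - p1) - (q2 * x2 - γ - p2) - q2 * (x1 - x2) := by ring
    rw [e]
    have h3 : |(q2 : ℝ) * (x1 - x2)| ≤ 1 / b ^ 26 / (q2 : ℝ) ^ i := by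
      rw [abs_mul, abs_of_pos hq2]; exact hu
    rw [abs_le] at *
    constructor <;> linarith [a1.1, a1.2, b1.1, b1.2, h3.1, h3.2]
  have hm : |((q1 : ℝ) - q2) * β - ((m1 : ℝ) - m2)| ≤
      1 / b ^ 30 / (q1 : ℝ) ^ j + 1 / b ^ 30 / (q2 : ℝ) ^ j := by
    have e : ((q1 : ℝ) - q2) * β - ((m1 : ℝ) - m2) =
      (q1 * β - η - m1) - (q2 * β - η - m2) := by ring
    rw [e]
    rw [abs_le] at *
    constructor <;> linarith [a2.1, a2.2, b2.1, b2.2]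
  have small : ∀ Q e c : ℝ, 0 < Q → 0 ≤ c → ∀ q : ℝ, 0 < q → Q ^ e ≤ b * q ^ e →
      c / q ^ e ≤ c * b / Q ^ e := by
    intro Q e c hQ hc q hq h
    have h1 : 0 < Q ^ e := Real.rpow_pos_of_pos hQ e
    have h2 : 0 < q ^ e := Real.rpow_pos_of_pos hq e
    rw [div_le_div_iff₀ h2 h1]
    nlinarith
  have hsum3 : 1 / b ^ 30 * b + 1 / b ^ 30 * b + 1 / b ^ 26 * b ≤ 1 / b ^ 20 := by
    have e1 : 1 / b ^ 30 * b ≤ 1 / b ^ 22 / b := by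
      rw [div_mul_eq_mul_div, div_div, div_le_div_iff₀ (by positivity) (by positivity), ← pow_succ]
      have : b ^ 24 ≤ b ^ 30 := pow_le_pow_right₀ hb1 (by norm_num)
      calc 1 * b * b ^ (22 + 1) = b ^ 24 := by ring
        _ ≤ _ := by linarith
    have e2 : 1 / b ^ 26 * b ≤ 1 / b ^ 22 / b := by
      rw [div_mul_eq_mul_div, div_div, div_le_div_iff₀ (by positivity) (by positivity), ← pow_succ]
      have : b ^ 24 ≤ b ^ 26 := pow_le_pow_right₀ hb1 (by norm_num)
      calc 1 * b * b ^ (22 + 1) = b ^ 24 := by ring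
        _ ≤ _ := by linarith
    have e3 : 3 * (1 / b ^ 22 / b) ≤ 1 / b ^ 20 := by
      have : 3 * (1 / b ^ 22 / b) = (3 / b ^ 3) * (1 / b ^ 20) := by field_simp
      rw [this]
      have h3 : 3 / b ^ 3 ≤ 1 := by
        rw [div_le_one (by positivity)]
        have : b ^ 1 ≤ b ^ 3 := pow_le_pow_right₀ hb1 (by norm_num)
        linarith
      have : 0 ≤ 1 / b ^ 20 := by positivity
      nlinarith
    linarith
  have hp30 : 0 ≤ 1 / b ^ 30 := by positivity
  have hp26 : 0 ≤ 1 / b ^ 26 := by positivity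
  -- equal denominators
  have hqq : q1 = q2 := by
    by_contra hne
    have main : ∀ (Q : ℕ) (p m : ℤ), 0 < Q → ((Q : ℝ) ≤ q1 ∨ (Q : ℝ) ≤ q2) →
        |(Q : ℝ) * x1 - p| = |((q1 : ℝ) - q2) * x1 - ((p1 : ℝ) - p2)| →
        |(Q : ℝ) * β - m| = |((q1 : ℝ) - q2) * β - ((m1 : ℝ) - m2)| → False := by
      intro Q p m hQ hQm e1 e2
      have hQR : (0 : ℝ) < Q := by exact_mod_cast hQ
      obtain ⟨s1, s2⟩ := hQb Q i hQR.le hi hi1 hQm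
      obtain ⟨s3, s4⟩ := hQb Q j hQR.le hj hj1 hQm
      have hQi : 0 < (Q : ℝ) ^ i := Real.rpow_pos_of_pos hQR i
      have hQj : 0 < (Q : ℝ) ^ j := Real.rpow_pos_of_pos hQR j
      have g := hW1 Q p m hQ ?_ ?_
      · -- height
        have hlt : (Q : ℝ) ^ i * Q < b ^ n := by
          have fin : ∀ q : ℝ, 0 < q → (Q : ℝ) ≤ q → q ^ i * q * b ^ 20 < b ^ (n + 1) →
              (Q : ℝ) ^ i * Q < b ^ n := by
            intro q hq h h'
            have h1 : (Q : ℝ) ^ i * Q ≤ q ^ i * q := by gcongr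
            have h2 : b ^ 1 ≤ b ^ 20 := pow_le_pow_right₀ hb1 (by norm_num)
            have h3 : 0 < q ^ i * q := by
              have := Real.rpow_pos_of_pos hq i
              positivity
            have h4 : b * (q ^ i * q) < b * b ^ n := by
              calc b * (q ^ i * q) ≤ b ^ 20 * (q ^ i * q) := by gcongr; linarith
                _ = q ^ i * q * b ^ 20 := by ring
                _ < _ := h'
                _ = _ := by ring
            exact lt_of_le_of_lt h1 (lt_of_mul_lt_mul_left h4 hb0.le)
          rcases hQm with h | h
          · exact fin q1 hq1 h a4
          · exact fin q2 hq2 h b4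
        linarith
      · rw [e2]
        refine hm.trans ?_
        have t1 := small Q j _ hQR hp30 q1 hq1 s3
        have t2 := small Q j _ hQR hp30 q2 hq2 s4
        calc _ ≤ 1 / b ^ 30 * b / (Q : ℝ) ^ j + 1 / b ^ 30 * b / (Q : ℝ) ^ j := by linarith
          _ = (1 / b ^ 30 * b + 1 / b ^ 30 * b) / (Q : ℝ) ^ j := by ring
          _ ≤ _ := by
            gcongr
            have : 0 ≤ 1 / b ^ 26 * b := by positivity
            linarith
      · rw [e1]
        refine hx.trans ?_
        have t1 := small Q i _ hQR hp30 q1 hq1 s1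
        have t2 := small Q i _ hQR hp30 q2 hq2 s2
        have t3 := small Q i _ hQR hp26 q2 hq2 s2
        calc _ ≤ 1 / b ^ 30 * b / (Q : ℝ) ^ i + 1 / b ^ 30 * b / (Q : ℝ) ^ i
              + 1 / b ^ 26 * b / (Q : ℝ) ^ i := by linarith
          _ = (1 / b ^ 30 * b + 1 / b ^ 30 * b + 1 / b ^ 26 * b) / (Q : ℝ) ^ i := by ring
          _ ≤ _ := by gcongr
    rcases lt_or_gt_of_ne hne with h | h
    · have hc : ((q2 - q1 : ℕ) : ℝ) = (q2 : ℝ) - q1 := Nat.cast_sub h.le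
      refine main (q2 - q1) (p2 - p1) (m2 - m1) (by omega) (Or.inr (by rw [hc]; linarith)) ?_ ?_
      · rw [← abs_neg, hc]; congr 1; push_cast; ring
      · rw [← abs_neg, hc]; congr 1; push_cast; ring
    · have hc : ((q1 - q2 : ℕ) : ℝ) = (q1 : ℝ) - q2 := Nat.cast_sub h.le
      refine main (q1 - q2) (p1 - p2) (m1 - m2) (by omega) (Or.inl (by rw [hc]; linarith)) ?_ ?_
      · rw [hc]; congr 1; push_cast; ring
      · rw [hc]; congr 1; push_cast; ring
  subst hqq
  have hX1' : 1 ≤ (q1 : ℝ) ^ i := Real.one_le_rpow (by exact_mod_cast q10) hi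
  have h20 : 1 / b ^ 20 < 1 := by
    rw [div_lt_one (by positivity)]
    exact one_lt_pow₀ (by linarith) (by norm_num)
  have hpp : p1 - p2 = 0 := by
    apply eq_zero_of_abs_lt
    have h1 : |(((p1 - p2 : ℤ)) : ℝ)| = |((q1 : ℝ) - q1) * x1 - ((p1 : ℝ) - p2)| := by
      rw [← abs_neg]; congr 1; push_cast; ring
    rw [h1]
    refine lt_of_le_of_lt hx (lt_of_le_of_lt ?_ h20)
    have d : ∀ c : ℝ, 0 ≤ c → c / (q1 : ℝ) ^ i ≤ c * b := by
      intro c hc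
      calc c / (q1 : ℝ) ^ i ≤ c := div_le_self hc hX1'
        _ ≤ c * b := le_mul_of_one_le_right hc hb1
    have := d _ hp30
    have := d _ hp26
    linarith
  have hp12 : (p1 : ℝ) = p2 := by exact_mod_cast (sub_eq_zero.1 hpp)
  have hfin : (q1 : ℝ) * |x1 - x2| ≤ 2 * (1 / b ^ 30 / (q1 : ℝ) ^ i) := by
    have e : (q1 : ℝ) * (x1 - x2) = (q1 * x1 - γ - p1) - (q1 * x2 - γ - p2) := by
      rw [hp12]; ring
    calc (q1 : ℝ) * |x1 - x2| = |(q1 : ℝ) * (x1 - x2)| := by rw [abs_mul, abs_of_pos hq1]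
      _ ≤ |q1 * x1 - γ - p1| + |q1 * x2 - γ - p2| := by rw [e]; exact abs_sub _ _
      _ ≤ _ := by linarith
  have hf2 : ((q1 : ℝ) ^ i * q1 * b ^ 20) * |x1 - x2| ≤ 2 * (1 / b ^ 10) := by
    calc ((q1 : ℝ) ^ i * q1 * b ^ 20) * |x1 - x2| = (q1 : ℝ) ^ i * b ^ 20 * (q1 * |x1 - x2|) := by
          ring
      _ ≤ (q1 : ℝ) ^ i * b ^ 20 * (2 * (1 / b ^ 30 / (q1 : ℝ) ^ i)) := by gcongr
      _ = 2 * (1 / b ^ 10) := by field_simp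
  have hf3 : b ^ n * |x1 - x2| ≤ 2 * (1 / b ^ 10) := le_trans (by gcongr) hf2
  rw [lt_div_iff₀ (by positivity)]
  calc |x1 - x2| * b ^ (n + 1) = b * (b ^ n * |x1 - x2|) := by ring
    _ ≤ b * (2 * (1 / b ^ 10)) := by gcongr
    _ = (2 / b ^ 2) / b ^ 7 := by field_simp
    _ < 1 / b ^ 7 := by
      gcongr
      rw [div_lt_one (by positivity)]
      nlinarith

end Classes

section TypeB

lemma dat_line (i j β c : ℝ) (hc : 0 < c) (q : ℕ) (p m A B C : ℤ) (x : ℝ)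
    (D : Dat i j β c q p m A B C x) : (q : ℝ) * |A * x + B * β + C| ≤ 2 * c := by
  have hq : (0 : ℝ) < q := by exact_mod_cast D.q0
  have hX : 0 < (q : ℝ) ^ i := Real.rpow_pos_of_pos hq i
  have hY : 0 < (q : ℝ) ^ j := Real.rpow_pos_of_pos hq j
  have l1 : (A : ℝ) * p + B * m + C * q = 0 := by exact_mod_cast D.line
  have a1 : |(A : ℝ)| * |(q : ℝ) * x - p| ≤ c := by
    calc _ ≤ (q : ℝ) ^ i * (c / (q : ℝ) ^ i) := by gcongr; exacts [D.hA, D.hp]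
      _ = c := by field_simp
  have a2 : |(B : ℝ)| * |(q : ℝ) * β - m| ≤ c := by
    calc _ ≤ (q : ℝ) ^ j * (c / (q : ℝ) ^ j) := by gcongr; exacts [D.hB, D.hm]
      _ = c := by field_simp
  have e : (q : ℝ) * (A * x + B * β + C) = A * (q * x - p) + B * (q * β - m) := by
    linear_combination l1
  calc (q : ℝ) * |A * x + B * β + C| = |(q : ℝ) * (A * x + B * β + C)| := by
        rw [abs_mul, abs_of_pos hq]
    _ ≤ |(A : ℝ)| * |q * x - p| + |(B : ℝ)| * |q * β - m| := by
        rw [e, ← abs_mul, ← abs_mul]; exact abs_add_le _ _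
    _ ≤ 2 * c := by linarith

/-- real estimates for wide classes -/
lemma tB_bounds (b K E c ρ A1 A2 B1 B2 X Y q F1 F2 G H d : ℝ)
    (hb : 0 < b) (hK : 0 < K) (hE : 0 < E) (hc : 0 < c) (hcρ : 4 * c ≤ ρ * K)
    (hρ : ρ * b ^ 7 = 1)
    (hA1 : 0 ≤ A1) (hA2 : 0 ≤ A2) (hB1 : 0 ≤ B1) (hB2 : 0 ≤ B2) (hX : 0 < X) (hY : 0 < Y)
    (hq : X * Y = q)
    (h1 : K ^ 4 * A1 ≤ X) (h2 : K ^ 4 * A2 ≤ b ^ 5 * X) (h3 : B1 ≤ Y) (h4 : B2 ≤ b ^ 5 * Y)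
    (h5 : X * q ≤ b ^ 5 * K ^ 4 * E) (f1 : E * F1 ≤ 2 * c * A1) (f2 : E * F2 ≤ 2 * c * A2)
    (hd : E * d ≤ ρ * K)
    (hG : G ≤ A1 * F2 + A2 * F1 + A1 * A2 * d) (hH : H ≤ B2 * F1 + B1 * (F2 + A2 * d)) :
    G * Y * K ^ 3 ≤ 2 * b ^ 3 ∧ K ^ 4 * (A1 * B2 + A2 * B1) ≤ 2 * b ^ 5 * q ∧
      H * X ≤ 4 * b ^ 3 * K := by
  have hρ0 : 0 < ρ := by
    by_contra h
    push Not at h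
    have : ρ * b ^ 7 ≤ 0 := mul_nonpos_of_nonpos_of_nonneg h (by positivity)
    linarith
  have S1 : K ^ 4 * (A1 * B2 + A2 * B1) ≤ 2 * b ^ 5 * q := by
    calc K ^ 4 * (A1 * B2 + A2 * B1) = (K ^ 4 * A1) * B2 + (K ^ 4 * A2) * B1 := by ring
      _ ≤ X * (b ^ 5 * Y) + (b ^ 5 * X) * Y := by gcongr
      _ = 2 * b ^ 5 * q := by rw [← hq]; ring
  have hEG : E * G ≤ 2 * ρ * K * (A1 * A2) := by
    calc E * G ≤ E * (A1 * F2 + A2 * F1 + A1 * A2 * d) := by gcongr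
      _ = A1 * (E * F2) + A2 * (E * F1) + A1 * A2 * (E * d) := by ring
      _ ≤ A1 * (2 * c * A2) + A2 * (2 * c * A1) + A1 * A2 * (ρ * K) := by gcongr
      _ = (4 * c + ρ * K) * (A1 * A2) := by ring
      _ ≤ (ρ * K + ρ * K) * (A1 * A2) := by gcongr
      _ = _ := by ring
  have hEH : E * H ≤ 2 * ρ * K * (A1 * B2 + A2 * B1) := by
    have t1 : 0 ≤ A1 * B2 := by positivity
    have t2 : 0 ≤ A2 * B1 := by positivity
    have t3 : 0 < ρ * K := by positivity
    calc E * H ≤ E * (B2 * F1 + B1 * (F2 + A2 * d)) := by gcongr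
      _ = B2 * (E * F1) + B1 * (E * F2) + B1 * A2 * (E * d) := by ring
      _ ≤ B2 * (2 * c * A1) + B1 * (2 * c * A2) + B1 * A2 * (ρ * K) := by gcongr
      _ = 2 * c * (A1 * B2) + (2 * c + ρ * K) * (A2 * B1) := by ring
      _ ≤ (2 * ρ * K) * (A1 * B2) + (2 * ρ * K) * (A2 * B1) := by
          have u1 : 2 * c ≤ 2 * ρ * K := by linarith
          have u2 : 2 * c + ρ * K ≤ 2 * ρ * K := by linarith
          exact add_le_add (mul_le_mul_of_nonneg_right u1 t1) (mul_le_mul_of_nonneg_right u2 t2)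
      _ = _ := by ring
  refine ⟨?_, S1, ?_⟩
  · have h : (E * K ^ 5) * (G * Y * K ^ 3) ≤ (E * K ^ 5) * (2 * b ^ 3) := by
      calc (E * K ^ 5) * (G * Y * K ^ 3) = (E * G) * (Y * K ^ 8) := by ring
        _ ≤ (2 * ρ * K * (A1 * A2)) * (Y * K ^ 8) := by gcongr
        _ = 2 * ρ * K * Y * ((K ^ 4 * A1) * (K ^ 4 * A2)) := by ring
        _ ≤ 2 * ρ * K * Y * (X * (b ^ 5 * X)) := by gcongr
        _ = 2 * ρ * K * b ^ 5 * (X * q) := by rw [← hq]; ring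
        _ ≤ 2 * ρ * K * b ^ 5 * (b ^ 5 * K ^ 4 * E) := by gcongr
        _ = (ρ * b ^ 7) * ((E * K ^ 5) * (2 * b ^ 3)) := by ring
        _ = _ := by rw [hρ, one_mul]
    exact le_of_mul_le_mul_left h (by positivity)
  · have h : (E * K ^ 4) * (H * X) ≤ (E * K ^ 4) * (4 * b ^ 3 * K) := by
      calc (E * K ^ 4) * (H * X) = (E * H) * (X * K ^ 4) := by ring
        _ ≤ (2 * ρ * K * (A1 * B2 + A2 * B1)) * (X * K ^ 4) := by gcongr
        _ = 2 * ρ * K * X * (K ^ 4 * (A1 * B2 + A2 * B1)) := by ring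
        _ ≤ 2 * ρ * K * X * (2 * b ^ 5 * q) := by gcongr
        _ = 4 * ρ * K * b ^ 5 * (X * q) := by ring
        _ ≤ 4 * ρ * K * b ^ 5 * (b ^ 5 * K ^ 4 * E) := by gcongr
        _ = (ρ * b ^ 7) * ((E * K ^ 4) * (4 * b ^ 3 * K)) := by ring
        _ = _ := by rw [hρ, one_mul]
    exact le_of_mul_le_mul_left h (by positivity)

/-- the auxiliary point is dangerous and too small -/
lemma tB_small (i j b K E M Q q G H S : ℝ) (hi : 1 / 2 ≤ i) (hj : 0 ≤ j)
    (hb : 8 ≤ b) (hK : b ^ 27 ≤ K) (hEM : E = M * K) (hM : 0 < M) (hQ : 0 < Q) (hq : 0 < q)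
    (hG : G * q ^ j * K ^ 3 ≤ 2 * b ^ 3) (hG0 : 0 ≤ G) (hH0 : 0 ≤ H) (hQS : Q ≤ S)
    (hS : K ^ 4 * S ≤ 2 * b ^ 5 * q)
    (hH : H * q ^ i ≤ 4 * b ^ 3 * K) (h5 : q ^ i * q ≤ b ^ 5 * K ^ 4 * E) :
    G ≤ 1 / b ^ 20 / Q ^ j ∧ H ≤ 1 / b ^ 20 / Q ^ i ∧ Q ^ i * Q < M := by
  have hb0 : 0 < b := by linarith
  have hb1 : 1 ≤ b := by linarith
  have hK0 : 0 < K := lt_of_lt_of_le (by positivity) hK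
  have hK1 : 1 ≤ K := le_trans (one_le_pow₀ hb1) hK
  have hX : 0 < q ^ i := Real.rpow_pos_of_pos hq i
  have hY : 0 < q ^ j := Real.rpow_pos_of_pos hq j
  have hQi : 0 < Q ^ i := Real.rpow_pos_of_pos hQ i
  have hQj : 0 < Q ^ j := Real.rpow_pos_of_pos hQ j
  have hb2 : 2 * b ^ 5 ≤ b ^ 6 := by
    have : 0 < b ^ 5 := by positivity
    nlinarith
  have hQK : K ^ 4 * Q ≤ b ^ 6 * q := by
    calc K ^ 4 * Q ≤ K ^ 4 * S := by gcongr
      _ ≤ 2 * b ^ 5 * q := hS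
      _ ≤ _ := by gcongr
  have hQt : Q ≤ (b ^ 3 / K ^ 2) ^ 2 * q := by
    have : (b ^ 3 / K ^ 2) ^ 2 * q = b ^ 6 * q / K ^ 4 := by field_simp
    rw [this, le_div_iff₀ (by positivity)]
    linarith
  have ht0 : 0 < b ^ 3 / K ^ 2 := by positivity
  have hbK : b ^ 3 ≤ K := le_trans (pow_le_pow_right₀ hb1 (by norm_num)) hK
  have ht1 : b ^ 3 / K ^ 2 ≤ 1 := by
    rw [div_le_one (by positivity)]
    nlinarith
  have hQq : Q ≤ q := by
    refine hQt.trans ?_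
    have : (b ^ 3 / K ^ 2) ^ 2 ≤ 1 := pow_le_one₀ ht0.le ht1
    nlinarith
  have hQj' : Q ^ j ≤ q ^ j := Real.rpow_le_rpow hQ.le hQq hj
  have hQi' : Q ^ i ≤ b ^ 3 / K ^ 2 * q ^ i := by
    calc Q ^ i ≤ ((b ^ 3 / K ^ 2) ^ 2 * q) ^ i := Real.rpow_le_rpow hQ.le hQt (by linarith)
      _ = ((b ^ 3 / K ^ 2) ^ 2) ^ i * q ^ i := Real.mul_rpow (by positivity) hq.le
      _ ≤ b ^ 3 / K ^ 2 * q ^ i := by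
        gcongr
        calc ((b ^ 3 / K ^ 2) ^ 2) ^ i = (b ^ 3 / K ^ 2) ^ (2 * i) := by
              rw [← Real.rpow_natCast, ← Real.rpow_mul ht0.le]; norm_num
          _ ≤ (b ^ 3 / K ^ 2) ^ (1 : ℝ) :=
              Real.rpow_le_rpow_of_exponent_ge ht0 ht1 (by linarith)
          _ = _ := Real.rpow_one _
  refine ⟨?_, ?_, ?_⟩
  · rw [div_div, le_div_iff₀ (by positivity)]
    have h1 : G * Q ^ j * K ^ 3 ≤ 2 * b ^ 3 := le_trans (by gcongr) hG
    have h2 : 2 * b ^ 3 * b ^ 20 ≤ K ^ 3 := by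
      calc 2 * b ^ 3 * b ^ 20 ≤ b * b ^ 3 * b ^ 20 := by gcongr; linarith
        _ = b ^ 24 := by ring
        _ ≤ b ^ 27 := pow_le_pow_right₀ hb1 (by norm_num)
        _ ≤ K := hK
        _ ≤ K ^ 3 := le_self_pow₀ hK1 (by norm_num)
    have h3 : (G * (b ^ 20 * Q ^ j)) * K ^ 3 ≤ 1 * K ^ 3 := by
      calc (G * (b ^ 20 * Q ^ j)) * K ^ 3 = (G * Q ^ j * K ^ 3) * b ^ 20 := by ring
        _ ≤ (2 * b ^ 3) * b ^ 20 := by gcongr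
        _ ≤ _ := by linarith
    exact le_of_mul_le_mul_right h3 (by positivity)
  · rw [div_div, le_div_iff₀ (by positivity)]
    calc H * (b ^ 20 * Q ^ i) ≤ H * (b ^ 20 * (b ^ 3 / K ^ 2 * q ^ i)) := by gcongr
      _ = (H * q ^ i) * (b ^ 23 / K ^ 2) := by ring
      _ ≤ (4 * b ^ 3 * K) * (b ^ 23 / K ^ 2) := by gcongr
      _ = 4 * b ^ 26 / K := by field_simp
      _ ≤ 1 := by
        rw [div_le_one hK0]
        refine le_trans ?_ hK
        have : 0 < b ^ 26 := by positivity
        nlinarith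
  · calc Q ^ i * Q ≤ (b ^ 3 / K ^ 2 * q ^ i) * ((b ^ 3 / K ^ 2) ^ 2 * q) := by gcongr
      _ = b ^ 9 / K ^ 6 * (q ^ i * q) := by field_simp
      _ ≤ b ^ 9 / K ^ 6 * (b ^ 5 * K ^ 4 * E) := by gcongr
      _ = b ^ 14 / K * M := by rw [hEM]; field_simp
      _ < 1 * M := by
        gcongr
        rw [div_lt_one hK0]
        refine lt_of_lt_of_le ?_ hK
        exact pow_lt_pow_right₀ (by linarith) (by norm_num)
      _ = M := one_mul M

set_option maxHeartbeats 1600000 in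
lemma typeB (i j β b : ℝ) (hi : 1 / 2 ≤ i) (hi1 : i ≤ 1) (hj : 0 ≤ j) (hj1 : j ≤ 1)
    (hij : i + j = 1) (hb : 8 ≤ b)
    (m k : ℕ) (hk : 27 ≤ k) (x1 x2 : ℝ) (H1 : ClassH i j β b (m + k) k x1)
    (H2 : ClassH i j β b (m + k) k x2) (hW : WGood i j β b m x1)
    (hd : |x1 - x2| ≤ 1 / b ^ 7 / b ^ m) : |x1 - x2| < 1 / b ^ 7 / b ^ (m + k + 1) := by
  obtain ⟨q1, p1, m1, A1, B1, C1, D1, a1, a2, a3, a4⟩ := H1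
  obtain ⟨q2, p2, m2, A2, B2, C2, D2, b1, b2, b3, b4⟩ := H2
  have hb0 : 0 < b := by linarith
  have hb1 : 1 ≤ b := by linarith
  have hq1 : (0 : ℝ) < q1 := by exact_mod_cast D1.q0
  have hq2 : (0 : ℝ) < q2 := by exact_mod_cast D2.q0
  have hA1 : 0 < |(A1 : ℝ)| := abs_pos.2 (by exact_mod_cast D1.A0)
  have hA2 : 0 < |(A2 : ℝ)| := abs_pos.2 (by exact_mod_cast D2.A0)
  have hl : 1 ≤ b ^ 5 := one_le_pow₀ hb1
  have hi0 : 0 ≤ i := by linarith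
  obtain ⟨h5, -⟩ := class_ratio i b hi0 hb (m + k) k q1 q2 _ _ hq1 hq2 hA1 a2 a4 b1 b3
  obtain ⟨-, r21⟩ := class_ratio i b hi0 hb (m + k) k q2 q1 _ _ hq2 hq1 hA2 b2 b4 a1 a3
  have hX := rpow_le_scale _ _ _ i hq2.le hq1.le hl hi0 hi1 r21
  have hY := rpow_le_scale _ _ _ j hq2.le hq1.le hl hj hj1 r21
  have hX0 : 0 < (q1 : ℝ) ^ i := Real.rpow_pos_of_pos hq1 i
  have hY0 : 0 < (q1 : ℝ) ^ j := Real.rpow_pos_of_pos hq1 j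
  have hK4 : b ^ (4 * k) = (b ^ k) ^ 4 := by rw [mul_comm, pow_mul]
  rw [hK4] at h5 a3 b3
  have hK : b ^ 27 ≤ b ^ k := pow_le_pow_right₀ hb1 hk
  have hEM : b ^ (m + k) = b ^ m * b ^ k := pow_add b m k
  have hM : 0 < b ^ m := by positivity
  have hE : 0 < b ^ (m + k) := by positivity
  have hc : 0 < 1 / b ^ 20 := by positivity
  have hc4 : 4 * (1 / b ^ 20) < 1 / b ^ 7 / b := by
    have : 4 * (1 / b ^ 20) = (4 / b ^ 12) * (1 / b ^ 7 / b) := by field_simp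
    rw [this]
    apply mul_lt_of_lt_one_left (by positivity)
    rw [div_lt_one (by positivity)]
    have : b ^ 1 ≤ b ^ 12 := pow_le_pow_right₀ hb1 (by norm_num)
    linarith
  unfold WGood at hW
  rw [pow_succ b (m + k)]
  generalize b ^ k = K at *
  generalize b ^ m = M at *
  generalize b ^ (m + k) = E at *
  have hK0 : 0 < K := lt_of_lt_of_le (by positivity) hK
  have hK1 : 1 ≤ K := le_trans (one_le_pow₀ hb1) hK
  set f1 := (A1 : ℝ) * x1 + B1 * β + C1 with hf1
  set f2 := (A2 : ℝ) * x2 + B2 * β + C2 with hf2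
  have F1 : E * |f1| ≤ 2 * (1 / b ^ 20) * |(A1 : ℝ)| := by
    have := dat_line i j β _ hc _ _ _ _ _ _ _ D1
    calc E * |f1| ≤ (|(A1 : ℝ)| * q1) * |f1| := by gcongr
      _ = |(A1 : ℝ)| * (q1 * |f1|) := by ring
      _ ≤ |(A1 : ℝ)| * (2 * (1 / b ^ 20)) := by gcongr
      _ = _ := by ring
  have F2 : E * |f2| ≤ 2 * (1 / b ^ 20) * |(A2 : ℝ)| := by
    have := dat_line i j β _ hc _ _ _ _ _ _ _ D2
    calc E * |f2| ≤ (|(A2 : ℝ)| * q2) * |f2| := by gcongr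
      _ = |(A2 : ℝ)| * (q2 * |f2|) := by ring
      _ ≤ |(A2 : ℝ)| * (2 * (1 / b ^ 20)) := by gcongr
      _ = _ := by ring
  have hEd : E * |x1 - x2| ≤ 1 / b ^ 7 * K := by
    calc E * |x1 - x2| ≤ E * (1 / b ^ 7 / M) := by gcongr
      _ = 1 / b ^ 7 * K := by rw [hEM]; field_simp
  set q0 : ℤ := A1 * B2 - A2 * B1 with hq0
  set m0 : ℤ := C1 * A2 - C2 * A1 with hm0
  set p0 : ℤ := B1 * C2 - B2 * C1 with hp0
  have eG : (q0 : ℝ) * β - m0 = A1 * f2 - A2 * f1 + A1 * A2 * (x1 - x2) := by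
    rw [hq0, hm0, hf1, hf2]; push_cast; ring
  have eH : (q0 : ℝ) * x1 - p0 = B2 * f1 - B1 * (f2 + A2 * (x1 - x2)) := by
    rw [hq0, hp0, hf1, hf2]; push_cast; ring
  have hG : |(q0 : ℝ) * β - m0| ≤ |(A1 : ℝ)| * |f2| + |(A2 : ℝ)| * |f1|
      + |(A1 : ℝ)| * |(A2 : ℝ)| * |x1 - x2| := by
    rw [eG, ← abs_mul, ← abs_mul, ← abs_mul, ← abs_mul]
    exact (abs_add_le _ _).trans (by gcongr; exact abs_sub _ _)
  have hH : |(q0 : ℝ) * x1 - p0| ≤ |(B2 : ℝ)| * |f1| + |(B1 : ℝ)| * (|f2|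
      + |(A2 : ℝ)| * |x1 - x2|) := by
    rw [eH]
    refine (abs_sub _ _).trans ?_
    rw [abs_mul, abs_mul, ← abs_mul (A2 : ℝ)]
    gcongr
    exact abs_add_le _ _
  have hc4' : 4 * (1 / b ^ 20) ≤ 1 / b ^ 7 * K := by
    have h1 : 1 / b ^ 7 / b ≤ 1 / b ^ 7 := div_le_self (by positivity) hb1
    have h2 : 1 / b ^ 7 ≤ 1 / b ^ 7 * K := le_mul_of_one_le_right (by positivity) hK1
    linarith
  have hXY : (q1 : ℝ) ^ i * (q1 : ℝ) ^ j = q1 := by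
    rw [← Real.rpow_add hq1, hij, Real.rpow_one]
  obtain ⟨g1, g2, g3⟩ := tB_bounds b K E (1 / b ^ 20) (1 / b ^ 7) |(A1 : ℝ)| |(A2 : ℝ)|
    |(B1 : ℝ)| |(B2 : ℝ)| ((q1 : ℝ) ^ i) ((q1 : ℝ) ^ j) q1 |f1| |f2| |(q0 : ℝ) * β - m0|
    |(q0 : ℝ) * x1 - p0| |x1 - x2| hb0 hK0 hE hc hc4' (by field_simp) hA1.le hA2.le
    (abs_nonneg _) (abs_nonneg _) hX0 hY0 hXY a3 (b3.trans hX) D1.hB (D2.hB.trans hY) h5 F1 F2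
    hEd hG hH
  by_cases hq00 : q0 = 0
  · have hm00 : m0 = 0 := by
      apply eq_zero_of_abs_lt
      have e : |(q0 : ℝ) * β - m0| = |(m0 : ℝ)| := by rw [hq00]; simp
      rw [e] at g1
      have hY1 : 1 ≤ (q1 : ℝ) ^ j := Real.one_le_rpow (by exact_mod_cast D1.q0) hj
      by_contra hcon
      push Not at hcon
      have h1 : K ^ 3 ≤ 2 * b ^ 3 := by
        calc K ^ 3 = 1 * 1 * K ^ 3 := by ring
          _ ≤ |(m0 : ℝ)| * (q1 : ℝ) ^ j * K ^ 3 := by gcongr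
          _ ≤ _ := g1
      have h2 : 2 * b ^ 3 < K ^ 3 := by
        calc 2 * b ^ 3 < b * b ^ 3 := by
              have : 0 < b ^ 3 := by positivity
              nlinarith
          _ = b ^ 4 := by ring
          _ ≤ b ^ 27 := pow_le_pow_right₀ hb1 (by norm_num)
          _ ≤ K := hK
          _ ≤ K ^ 3 := le_self_pow₀ hK1 (by norm_num)
      linarith
    have e : (A1 : ℝ) * A2 * (x1 - x2) = A2 * f1 - A1 * f2 := by
      have := eG
      rw [hq00, hm00] at this
      push_cast at this
      linarith
    have h1 : |(A1 : ℝ)| * |(A2 : ℝ)| * (E * |x1 - x2|) ≤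
        |(A1 : ℝ)| * |(A2 : ℝ)| * (4 * (1 / b ^ 20)) := by
      calc |(A1 : ℝ)| * |(A2 : ℝ)| * (E * |x1 - x2|) = E * |(A1 : ℝ) * A2 * (x1 - x2)| := by
            rw [abs_mul, abs_mul]; ring
        _ ≤ E * (|(A2 : ℝ)| * |f1| + |(A1 : ℝ)| * |f2|) := by
            rw [e, ← abs_mul, ← abs_mul]
            gcongr
            exact abs_sub _ _
        _ = |(A2 : ℝ)| * (E * |f1|) + |(A1 : ℝ)| * (E * |f2|) := by ring
        _ ≤ |(A2 : ℝ)| * (2 * (1 / b ^ 20) * |(A1 : ℝ)|)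
            + |(A1 : ℝ)| * (2 * (1 / b ^ 20) * |(A2 : ℝ)|) := by gcongr
        _ = _ := by ring
    have h2 : E * |x1 - x2| ≤ 4 * (1 / b ^ 20) := le_of_mul_le_mul_left h1 (by positivity)
    rw [lt_div_iff₀ (by positivity)]
    have h3 : E * |x1 - x2| < 1 / b ^ 7 / b := by linarith
    rw [lt_div_iff₀ hb0] at h3
    linarith
  · exfalso
    have hQc : ((q0.natAbs : ℕ) : ℝ) = |(q0 : ℝ)| := by rw [Nat.cast_natAbs, Int.cast_abs]
    have hQ0 : (0 : ℝ) < |(q0 : ℝ)| := abs_pos.2 (by exact_mod_cast hq00)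
    have hQS : |(q0 : ℝ)| ≤ |(A1 : ℝ)| * |(B2 : ℝ)| + |(A2 : ℝ)| * |(B1 : ℝ)| := by
      rw [← abs_mul, ← abs_mul, hq0]
      push_cast
      exact abs_sub _ _
    obtain ⟨s1, s2, s3⟩ := tB_small i j b K E M |(q0 : ℝ)| q1 _ _ _ hi hj hb hK hEM hM hQ0 hq1
      g1 (abs_nonneg _) (abs_nonneg _) hQS g2 g3 h5
    have fin : ∀ p m : ℤ, |((q0.natAbs : ℕ) : ℝ) * β - m| = |(q0 : ℝ) * β - m0| →
        |((q0.natAbs : ℕ) : ℝ) * x1 - p| = |(q0 : ℝ) * x1 - p0| → False := by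
      intro p m' e1 e2
      have := hW q0.natAbs p m' (Int.natAbs_pos.2 hq00) (by rw [e1, hQc]; exact s1)
        (by rw [e2, hQc]; exact s2)
      rw [hQc] at this
      linarith
    rcases le_total 0 q0 with hs | hs
    · have hz : |(q0 : ℝ)| = q0 := abs_of_nonneg (by exact_mod_cast hs)
      exact fin p0 m0 (by rw [hQc, hz]) (by rw [hQc, hz])
    · have hz : |(q0 : ℝ)| = -q0 := abs_of_nonpos (by exact_mod_cast hs)
      refine fin (-p0) (-m0) ?_ ?_
      · rw [hQc, hz, ← abs_neg]; congr 1; push_cast; ring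
      · rw [hQc, hz, ← abs_neg]; congr 1; push_cast; ring

end TypeB

section Assembly
open scoped ENNReal

/-- shift of a class -/
def sh (k : ℕ) : ℕ := if k < 27 then 0 else k

/-- depth of a kill type -/
def ell : ℕ → ℕ
  | 0 => 1
  | k + 1 => sh k + 1

/-- the bad predicate of a kill type -/
def BadT (i j β γ η b : ℝ) : ℕ → ℕ → ℝ → Prop
  | 0, m, x => ClassI i j β γ η b m x
  | k + 1, m, x => ClassH i j β b (m + sh k) k x

lemma badT_close (i j β γ η b : ℝ) (hi : 1 / 2 ≤ i) (hi1 : i ≤ 1) (hj : 0 ≤ j) (hj1 : j ≤ 1)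
    (hij : i + j = 1) (hb : 8 ≤ b) (τ m : ℕ) (x1 x2 : ℝ) (H1 : BadT i j β γ η b τ m x1)
    (H2 : BadT i j β γ η b τ m x2) (hW : WGood i j β b m x1)
    (hd : |x1 - x2| ≤ 1 / b ^ 7 / b ^ m) : |x1 - x2| < 1 / b ^ 7 / b ^ (m + ell τ) := by
  have hi0 : 0 ≤ i := by linarith
  cases τ with
  | zero => exact typeC i j β γ η b hi0 hi1 hj hj1 hb m x1 x2 H1 H2 hW hd
  | succ k =>
    by_cases hk : k < 27
    · have e : sh k = 0 := by simp [sh, hk]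
      simp only [BadT, ell, e] at H1 H2 ⊢
      exact typeA i j β b hi0 hi1 hj hj1 hb m k x1 x2 H1 H2 hd
    · have e : sh k = k := by simp [sh, hk]
      simp only [BadT, ell, e] at H1 H2 ⊢
      exact typeB i j β b hi hi1 hj hj1 hij hb m k (by omega) x1 x2 H1 H2 hW hd

open Classical in
/-- the killed word -/
noncomputable def kap (N : ℕ) (hN : 0 < N) (ρ : ℝ) (P : ℕ → ℕ → ℝ → Prop) (τ : ℕ)
    (w : List (Fin (2 * N))) : List (Fin (2 * N)) :=
  if h : ∃ u : List (Fin (2 * N)), u.length = ell τ ∧ ∃ x ∈ cell N ρ (u ++ w), P τ w.length x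
  then h.choose else List.replicate (ell τ) ⟨0, by omega⟩

lemma kap_length (N : ℕ) (hN : 0 < N) (ρ : ℝ) (P : ℕ → ℕ → ℝ → Prop) (τ : ℕ)
    (w : List (Fin (2 * N))) : (kap N hN ρ P τ w).length = ell τ := by
  unfold kap
  split_ifs with h
  · exact h.choose_spec.1
  · simp

lemma kap_unique (N : ℕ) (hN : 0 < N) (ρ : ℝ) (hρ : 0 < ρ) (P : ℕ → ℕ → ℝ → Prop) (τ : ℕ)
    (w : List (Fin (2 * N)))
    (hclose : ∀ x ∈ cell N ρ w, ∀ y ∈ cell N ρ w, P τ w.length x → P τ w.length y →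
      |x - y| < ρ / (4 * N : ℝ) ^ (w.length + ell τ))
    (u : List (Fin (2 * N))) (hu : u.length = ell τ) (x : ℝ) (hx : x ∈ cell N ρ (u ++ w))
    (hP : P τ w.length x) : u = kap N hN ρ P τ w := by
  have h : ∃ u : List (Fin (2 * N)), u.length = ell τ ∧
    ∃ x ∈ cell N ρ (u ++ w), P τ w.length x := ⟨u, hu, x, hx, hP⟩
  have e : kap N hN ρ P τ w = h.choose := by
    unfold kap
    rw [dif_pos h]
  rw [e]
  obtain ⟨hl, y, hy, hPy⟩ := h.choose_spec
  generalize h.choose = u' at *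
  have := cell_sep N hN ρ hρ (u ++ w) (u' ++ w) (by simp [hu, hl]) x y hx hy (by
    rw [List.length_append, hu, add_comm]
    exact hclose x (cell_append N hN ρ hρ _ _ hx) y (cell_append N hN ρ hρ _ _ hy) hP hPy)
  exact List.append_cancel_right this

lemma suffix_mem {R : ℕ} (T : Set (List (Fin R))) (hT : ∀ r w, r :: w ∈ T → w ∈ T)
    (n : ℕ) (w : List (Fin R)) (hw : w ∈ T) (hn : n ≤ w.length) :
    ∃ u w', w = u ++ w' ∧ w'.length = n ∧ w' ∈ T := by
  induction w with
  | nil => exact ⟨[], [], rfl, by simp at hn; simp [hn], hw⟩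
  | cons r w ih =>
    by_cases h : n = (r :: w).length
    · exact ⟨[], r :: w, rfl, h.symm, hw⟩
    · obtain ⟨u, w', e, hl, hm⟩ := ih (hT r w hw) (by simp at hn h; omega)
      exact ⟨r :: u, w', by rw [e]; rfl, hl, hm⟩

lemma ell_sum (N : ℕ) (hN : 2 ^ 30 ≤ N) :
    ∑' k, (((N : ℝ≥0∞) / 2)⁻¹) ^ (ell k) ≤ 1 / 2 := by
  have h2 : (2 : ℝ≥0∞) ^ 29 ≤ (N : ℝ≥0∞) / 2 := by
    rw [ENNReal.le_div_iff_mul_le (by simp) (by simp)]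
    calc (2 : ℝ≥0∞) ^ 29 * 2 = ((2 ^ 30 : ℕ) : ℝ≥0∞) := by push_cast; ring
      _ ≤ _ := by exact_mod_cast hN
  have ht : ((N : ℝ≥0∞) / 2)⁻¹ ≤ (2⁻¹ : ℝ≥0∞) ^ 29 := by
    rw [← ENNReal.inv_pow]
    exact ENNReal.inv_le_inv.2 h2
  have hterm : ∀ k, (((N : ℝ≥0∞) / 2)⁻¹) ^ (ell k) ≤ 2⁻¹ ^ 2 * 2⁻¹ ^ k := by
    intro k
    calc (((N : ℝ≥0∞) / 2)⁻¹) ^ (ell k) ≤ ((2⁻¹ : ℝ≥0∞) ^ 29) ^ (ell k) := by gcongr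
      _ = (2⁻¹ : ℝ≥0∞) ^ (29 * ell k) := by rw [pow_mul]
      _ ≤ (2⁻¹ : ℝ≥0∞) ^ (2 + k) := by
        apply pow_le_pow_right_of_le_one' (by simp)
        cases k with
        | zero => simp [ell]
        | succ k =>
          simp only [ell, sh]
          split_ifs <;> omega
      _ = _ := pow_add _ _ _
  calc _ ≤ ∑' k, ((2⁻¹ : ℝ≥0∞) ^ 2 * 2⁻¹ ^ k) := ENNReal.tsum_le_tsum hterm
    _ = 2⁻¹ ^ 2 * (1 - 2⁻¹)⁻¹ := by rw [ENNReal.tsum_mul_left, ENNReal.tsum_geometric]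
    _ = 2⁻¹ * (2⁻¹ * 2) := by rw [ENNReal.one_sub_inv_two, inv_inv]; ring
    _ ≤ 1 / 2 := by
      rw [ENNReal.inv_mul_cancel (by simp) (by simp)]; simp

/-- all data at points of the cell have large height -/
def Good (i j β : ℝ) (N : ℕ) (w : List (Fin (2 * N))) : Prop :=
  ∀ x ∈ cell N (1 / (4 * N : ℝ) ^ 7) w, ∀ (q : ℕ) (p m A B C : ℤ),
    Dat i j β (1 / (4 * N : ℝ) ^ 20) q p m A B C x → (4 * N : ℝ) ^ w.length ≤ |(A : ℝ)| * q

/-- the target set on a line -/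
def SLine (i j β γ η : ℝ) : Set ℝ :=
  {x | ∃ c : ℝ, 0 < c ∧ ∀ (q : ℕ) (p m : ℤ), 0 < q →
    ¬ (|(q : ℝ) * x - γ - p| ≤ c / (q : ℝ) ^ i ∧ |(q : ℝ) * β - η - m| ≤ c / (q : ℝ) ^ j)}

lemma exists_classH (i j β b : ℝ) (hi0 : 0 ≤ i) (hi1 : i ≤ 1) (hb : 8 ≤ b) (q : ℕ)
    (p m A B C : ℤ) (x : ℝ)
    (D : Dat i j β (1 / b ^ 20) q p m A B C x) (L : ℕ) (hL : |(A : ℝ)| * q < b ^ L) :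
    ∃ n k, n < L ∧ k ≤ n ∧ ClassH i j β b n k x := by
  have hb1 : 1 < b := by linarith
  have hq : (1 : ℝ) ≤ q := by exact_mod_cast D.q0
  have hA : (1 : ℝ) ≤ |(A : ℝ)| := by
    have : 1 ≤ |A| := Int.one_le_abs D.A0
    exact_mod_cast this
  have hA0 : (0 : ℝ) < |(A : ℝ)| := by linarith
  have h1 : 1 ≤ |(A : ℝ)| * q := by nlinarith
  obtain ⟨n, hn1, hn2⟩ := exists_nat_pow_near h1 hb1
  have h2 : 1 ≤ (q : ℝ) ^ i / |(A : ℝ)| := by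
    rw [le_div_iff₀ hA0]; linarith [D.hA]
  obtain ⟨k, hk1, hk2⟩ := exists_nat_pow_near h2 (show 1 < b ^ 4 from one_lt_pow₀ hb1 (by norm_num))
  rw [le_div_iff₀ hA0, ← pow_mul] at hk1
  rw [div_lt_iff₀ hA0, ← pow_mul] at hk2
  refine ⟨n, k, ?_, ?_, q, p, m, A, B, C, D, hn1, hn2, hk1, hk2⟩
  · exact (pow_lt_pow_iff_right₀ hb1).1 (lt_of_le_of_lt hn1 hL)
  · have h3 : b ^ (4 * k) < b ^ (n + 1) := by
      calc b ^ (4 * k) ≤ b ^ (4 * k) * |(A : ℝ)| := le_mul_of_one_le_right (by positivity) hA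
        _ ≤ (q : ℝ) ^ i := hk1
        _ ≤ (q : ℝ) ^ (1 : ℝ) := Real.rpow_le_rpow_of_exponent_le hq hi1
        _ = q := Real.rpow_one _
        _ ≤ |(A : ℝ)| * q := le_mul_of_one_le_left (by linarith) hA
        _ < _ := hn2
    have := (pow_lt_pow_iff_right₀ hb1).1 h3
    omega

theorem core_N (i j β γ η κ : ℝ) (hi : 1 / 2 ≤ i) (hi1 : i ≤ 1) (hj : 0 < j) (hj1 : j ≤ 1)
    (hij : i + j = 1)
    (hβ : ∀ (n : ℕ) (C : ℤ), 0 < n → κ ≤ (n : ℝ) ^ (1 / j) * |(n : ℝ) * β + C|)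
    (N : ℕ) (hN : 2 ^ 30 ≤ N) (hκ : 1 / (4 * N : ℝ) ^ 20 < κ) :
    ENNReal.ofReal (Real.log N / Real.log (4 * N)) ≤ dimH (SLine i j β γ η) := by
  have hN0 : 0 < N := by omega
  have hi0 : 0 ≤ i := by linarith
  have hNR : (2 : ℝ) ^ 30 ≤ N := by exact_mod_cast hN
  set b : ℝ := 4 * N with hbdef
  have hb : 8 ≤ b := by linarith
  have hb0 : 0 < b := by linarith
  have hb1 : 1 < b := by linarith
  set ρ : ℝ := 1 / b ^ 7 with hρdef
  have hρ : 0 < ρ := by positivity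
  set P := BadT i j β γ η b with hP
  obtain ⟨T, h0, hcl, hch, hk⟩ := tree_exists N hN0 (kap N hN0 ρ P) ell
    (fun k w => kap_length N hN0 ρ P k w)
    (fun k => by cases k <;> simp [ell]) (ell_sum N hN)
  have good_w : ∀ w, Good i j β N w → ∀ x ∈ cell N ρ w, WGood i j β b w.length x := by
    intro w hw x hx Q p m hQ hm hp
    obtain ⟨A, B, C, D⟩ := exists_line i j β _ κ hj hij hκ (by positivity) hβ Q hQ p m x hm hp
    refine (hw x hx Q p m A B C D).trans ?_
    gcongr
    exact D.hA
  -- no bad points one step below a good word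
  have kill : ∀ w, Good i j β N w → ∀ τ u x, u ++ w ∈ T → u.length = ell τ →
      x ∈ cell N ρ (u ++ w) → P τ w.length x → False := by
    intro w hw τ u x hT hu hx hPx
    have := kap_unique N hN0 ρ hρ P τ w (by
      intro x hx y hy h1 h2
      exact badT_close i j β γ η b hi hi1 hj.le hj1 hij hb τ w.length x y h1 h2
        (good_w w hw x hx) (cell_diam N ρ w x y hx hy)) u hu x hx hPx
    rw [this] at hT
    exact hk τ w hT
  have allgood : ∀ n, ∀ w ∈ T, w.length = n → Good i j β N w := by
    intro n
    induction n using Nat.strong_induction_on with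
    | _ n ih =>
      intro w hw hl x hx q p m A B C D
      by_contra hlt
      push Not at hlt
      obtain ⟨n0, k, hn0, hkn, hC⟩ := exists_classH i j β b hi0 hi1 hb q p m A B C x D _ hlt
      have hsk : sh k ≤ n0 := by unfold sh; split_ifs <;> omega
      obtain ⟨u1, v, e1, hv, hvT⟩ := suffix_mem T hcl (n0 + 1) w hw (by omega)
      obtain ⟨u, w', e2, hw', hwT⟩ := suffix_mem T hcl (n0 - sh k) v hvT (by omega)
      have hg : Good i j β N w' := ih (n0 - sh k) (by omega) w' hwT hw'
      have hxv : x ∈ cell N ρ (u ++ w') := by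
        rw [← e2]
        rw [e1] at hx
        exact cell_append N hN0 ρ hρ u1 v hx
      refine kill w' hg (k + 1) u x (e2 ▸ hvT) ?_ hxv ?_
      · have : v.length = u.length + w'.length := by rw [e2, List.length_append]
        simp only [ell]
        omega
      · simp only [hP, BadT]
        rw [hw', Nat.sub_add_cancel hsk]
        exact hC
  refine (cantor_dim N (by omega) ρ hρ T h0 hch).trans (dimH_mono ?_)
  intro x hx
  refine ⟨1 / b ^ 30, by positivity, ?_⟩
  rintro q p m hq ⟨hq1, hq2⟩
  have hqR : (1 : ℝ) ≤ q := by exact_mod_cast hq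
  have h1 : 1 ≤ (q : ℝ) ^ i * q * b ^ 20 := by
    have t1 : 1 ≤ (q : ℝ) ^ i := Real.one_le_rpow hqR hi0
    have t2 : 1 ≤ b ^ 20 := one_le_pow₀ hb1.le
    have t3 : 1 ≤ (q : ℝ) ^ i * q := one_le_mul_of_one_le_of_one_le t1 hqR
    exact one_le_mul_of_one_le_of_one_le t3 t2
  obtain ⟨n, hn1, hn2⟩ := exists_nat_pow_near h1 hb1
  obtain ⟨v, hvT, hvl, hxv⟩ := hx (n + 1)
  obtain ⟨u, w', e2, hw', hwT⟩ := suffix_mem T hcl n v hvT (by omega)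
  refine kill w' (allgood n w' hwT hw') 0 u x (e2 ▸ hvT) ?_ (e2 ▸ hxv) ?_
  · have : v.length = u.length + w'.length := by rw [e2, List.length_append]
    simp only [ell]
    omega
  · simp only [hP, BadT]
    rw [hw']
    exact ⟨q, p, m, hq, hq1, hq2, hn1, hn2⟩

theorem core (i j β γ η κ : ℝ) (hi : 1 / 2 ≤ i) (hi1 : i ≤ 1) (hj : 0 < j) (hj1 : j ≤ 1)
    (hij : i + j = 1) (hκ0 : 0 < κ)
    (hβ : ∀ (n : ℕ) (C : ℤ), 0 < n → κ ≤ (n : ℝ) ^ (1 / j) * |(n : ℝ) * β + C|) :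
    1 ≤ dimH (SLine i j β γ η) := by
  have hlog : Tendsto (fun N : ℕ => Real.log (4 * N)) atTop atTop :=
    Real.tendsto_log_atTop.comp (tendsto_natCast_atTop_atTop.const_mul_atTop (by norm_num))
  have h1 : Tendsto (fun N : ℕ => 1 - Real.log 4 / Real.log (4 * N)) atTop (nhds (1 - 0)) :=
    tendsto_const_nhds.sub (hlog.const_div_atTop _)
  have h2 : Tendsto (fun N : ℕ => Real.log N / Real.log (4 * N)) atTop (nhds 1) := by
    rw [sub_zero] at h1
    refine h1.congr' ?_
    filter_upwards [eventually_ge_atTop 1] with N hN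
    have hN : (1 : ℝ) ≤ N := by exact_mod_cast hN
    have h4 : 0 < Real.log (4 * N) := Real.log_pos (by linarith)
    have e : Real.log (4 * N) = Real.log 4 + Real.log N :=
      Real.log_mul (by norm_num) (by linarith)
    rw [eq_div_iff h4.ne', sub_mul, div_mul_cancel₀ _ h4.ne', e]
    ring
  have h3 := ENNReal.tendsto_ofReal h2
  rw [ENNReal.ofReal_one] at h3
  refine le_of_tendsto h3 ?_
  obtain ⟨N0, hN0⟩ := exists_nat_gt (1 / κ)
  filter_upwards [eventually_ge_atTop (2 ^ 30), eventually_ge_atTop N0] with N hN hN'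
  apply core_N i j β γ η κ hi hi1 hj hj1 hij hβ N hN
  have hNR : (2 : ℝ) ^ 30 ≤ N := by exact_mod_cast hN
  have hNR' : (N0 : ℝ) ≤ N := by exact_mod_cast hN'
  have hbb : (1 : ℝ) ≤ 4 * N := by linarith
  have h5 : (4 * N : ℝ) ≤ (4 * N : ℝ) ^ 20 := le_self_pow₀ hbb (by norm_num)
  rw [div_lt_iff₀ (by linarith)]
  rw [div_lt_iff₀ hκ0] at hN0
  nlinarith

end Assembly

section Final

lemma dist_le_int (t : ℝ) (z : ℤ) : distNearestInt t ≤ |t - z| := round_le t z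

lemma hbeta (a : ℚ) (b σ : ℝ) (hσ : 0 < σ)
    (hdio : 0 < Filter.atTop.liminf (fun q : ℕ =>
        ENNReal.ofReal ((q : ℝ) ^ (1 / σ) *
          max (distNearestInt ((q : ℝ) * (a : ℝ))) (distNearestInt ((q : ℝ) * b))))) :
    ∃ κ : ℝ, 0 < κ ∧ ∀ (n : ℕ) (C : ℤ), 0 < n →
      κ ≤ (n : ℝ) ^ (1 / σ) * |(n : ℝ) * ((a.den : ℝ) * b) + C| := by
  obtain ⟨ε', h0, h1⟩ := exists_between hdio
  have hev := Filter.eventually_lt_of_lt_liminf h1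
  obtain ⟨q1, hq1⟩ := Filter.eventually_atTop.1 hev
  have htop : ε' ≠ ⊤ := (lt_of_lt_of_le h1 le_top).ne
  have hε : 0 < ε'.toReal := ENNReal.toReal_pos h0.ne' htop
  set q0 := q1 + 1 with hq0
  have hq0R : (0 : ℝ) < q0 := by positivity
  have hs : (0 : ℝ) < a.den := by exact_mod_cast a.den_pos
  have hW : 0 < ((a.den : ℝ) * q0) ^ (1 / σ) * q0 := by positivity
  refine ⟨ε'.toReal / (((a.den : ℝ) * q0) ^ (1 / σ) * q0), by positivity, ?_⟩
  intro n C hn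
  have hnR : (0 : ℝ) < n := by exact_mod_cast hn
  have hge : q1 ≤ a.den * n * q0 := by
    have : 0 < a.den * n := Nat.mul_pos a.den_pos hn
    nlinarith
  have h2 := (ENNReal.lt_ofReal_iff_toReal_lt htop).1 (hq1 _ hge)
  have hd : (a.den : ℝ) * (a : ℝ) = a.num := by
    have := Rat.den_mul_eq_num a
    exact_mod_cast this
  have hz : distNearestInt (((a.den * n * q0 : ℕ) : ℝ) * (a : ℝ)) ≤ 0 := by
    refine (dist_le_int _ ((n : ℤ) * q0 * a.num)).trans ?_
    have : ((a.den * n * q0 : ℕ) : ℝ) * (a : ℝ) - (((n : ℤ) * q0 * a.num : ℤ) : ℝ) = 0 := by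
      push_cast
      linear_combination (n : ℝ) * q0 * hd
    rw [this, abs_zero]
  have hz2 : distNearestInt (((a.den * n * q0 : ℕ) : ℝ) * b) ≤
      q0 * |(n : ℝ) * ((a.den : ℝ) * b) + C| := by
    refine (dist_le_int _ (-(q0 * C))).trans (le_of_eq ?_)
    rw [← abs_of_pos hq0R, ← abs_mul]
    congr 1
    push_cast
    ring
  have hmax : max (distNearestInt (((a.den * n * q0 : ℕ) : ℝ) * (a : ℝ)))
      (distNearestInt (((a.den * n * q0 : ℕ) : ℝ) * b)) ≤
      q0 * |(n : ℝ) * ((a.den : ℝ) * b) + C| :=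
    max_le (hz.trans (by positivity)) hz2
  rw [div_le_iff₀ hW]
  have e : (((a.den * n * q0 : ℕ) : ℝ)) ^ (1 / σ) = ((a.den : ℝ) * q0) ^ (1 / σ) * (n : ℝ) ^ (1 / σ) := by
    rw [← Real.mul_rpow (by positivity) (by positivity)]
    congr 1
    push_cast
    ring
  calc ε'.toReal ≤ _ := h2.le
    _ ≤ (((a.den * n * q0 : ℕ) : ℝ)) ^ (1 / σ) * (q0 * |(n : ℝ) * ((a.den : ℝ) * b) + C|) := by
      gcongr
    _ = _ := by rw [e]; ring

lemma incl (e f : ℝ) (hf : 0 < f) (hfe : f ≤ e) (s r : ℤ) (hsr : 1 ≤ |(s : ℝ)| + |(r : ℝ)|)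
    (β γ δ u v : ℝ) (huv : s * v - r * u = β) (hu : u ∈ SLine e f β γ (s * δ - r * γ)) :
    ∃ c : ℝ, 0 < c ∧ ∀ q : ℕ, 0 < q →
      c / (q : ℝ) < max (distNearestInt ((q : ℝ) * u - γ) ^ (1 / e))
        (distNearestInt ((q : ℝ) * v - δ) ^ (1 / f)) := by
  obtain ⟨c, hc, H⟩ := hu
  have he : 0 < e := by linarith
  set W := |(s : ℝ)| + |(r : ℝ)| with hW
  have hW0 : 0 < W := by linarith
  set t := min 1 (c / W) with ht
  have ht0 : 0 < t := by positivity
  have ht1 : t ≤ 1 := min_le_left _ _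
  have htc : W * t ≤ c := by
    have : t ≤ c / W := min_le_right _ _
    rw [le_div_iff₀ hW0] at this
    linarith
  have htc' : t ≤ c := by nlinarith
  set c2 := t ^ (1 / f) with hc2
  have hc20 : 0 < c2 := Real.rpow_pos_of_pos ht0 _
  have hc21 : c2 ≤ 1 := Real.rpow_le_one ht0.le ht1 (by positivity)
  have hcf : c2 ^ f = t := by
    rw [hc2, ← Real.rpow_mul ht0.le, one_div_mul_cancel hf.ne', Real.rpow_one]
  have hce : c2 ^ e ≤ t := by
    rw [← hcf]
    exact Real.rpow_le_rpow_of_exponent_ge hc20 hc21 hfe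
  refine ⟨c2, hc20, ?_⟩
  intro q hq
  by_contra hcon
  push Not at hcon
  have hq1 : (1 : ℝ) ≤ q := by exact_mod_cast hq
  have hqR : (0 : ℝ) < q := by linarith
  have aux : ∀ d g : ℝ, 0 ≤ d → 0 < g → d ^ (1 / g) ≤ c2 / q → d ≤ c2 ^ g / (q : ℝ) ^ g := by
    intro d g hd hg h
    calc d = (d ^ (1 / g)) ^ g := by
          rw [← Real.rpow_mul hd, one_div_mul_cancel hg.ne', Real.rpow_one]
      _ ≤ (c2 / q) ^ g := Real.rpow_le_rpow (Real.rpow_nonneg hd _) h hg.le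
      _ = _ := Real.div_rpow hc20.le hqR.le g
  have d1 := aux _ e (abs_nonneg _) he ((le_max_left _ _).trans hcon)
  have d2 := aux _ f (abs_nonneg _) hf ((le_max_right _ _).trans hcon)
  have hqe : 0 < (q : ℝ) ^ e := Real.rpow_pos_of_pos hqR e
  have hqf : 0 < (q : ℝ) ^ f := Real.rpow_pos_of_pos hqR f
  have d1' : |(q : ℝ) * u - γ - round ((q : ℝ) * u - γ)| ≤ t / (q : ℝ) ^ e :=
    d1.trans (by gcongr)
  have d1f : |(q : ℝ) * u - γ - round ((q : ℝ) * u - γ)| ≤ t / (q : ℝ) ^ f :=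
    d1'.trans (by gcongr)
  have d2' : |(q : ℝ) * v - δ - round ((q : ℝ) * v - δ)| ≤ t / (q : ℝ) ^ f := by
    rw [hcf] at d2
    exact d2
  generalize round ((q : ℝ) * u - γ) = p1 at *
  generalize round ((q : ℝ) * v - δ) = p2 at *
  refine H q p1 (s * p2 - r * p1) hq ⟨d1'.trans (by gcongr), ?_⟩
  have eq : (q : ℝ) * β - (s * δ - r * γ) - ((s * p2 - r * p1 : ℤ) : ℝ) =
      s * (q * v - δ - p2) - r * (q * u - γ - p1) := by
    rw [← huv]; push_cast; ring
  rw [eq]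
  calc |s * (q * v - δ - p2) - r * (q * u - γ - p1)|
      ≤ |(s : ℝ)| * |q * v - δ - p2| + |(r : ℝ)| * |q * u - γ - p1| := by
        rw [← abs_mul, ← abs_mul]; exact abs_sub _ _
    _ ≤ |(s : ℝ)| * (t / (q : ℝ) ^ f) + |(r : ℝ)| * (t / (q : ℝ) ^ f) := by gcongr
    _ = (W * t) / (q : ℝ) ^ f := by rw [hW]; ring
    _ ≤ c / (q : ℝ) ^ f := by gcongr

end Final

theorem stmt3 (i j : ℝ) (θ : ℝ × ℝ) (a : ℚ) (b : ℝ)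
    (hi0 : 0 < i) (hi1 : i < 1) (hj0 : 0 < j) (hj1 : j < 1) (hij : i + j = 1)
    (ha : a ≠ 0)
    (hdio : 0 < Filter.atTop.liminf (fun q : ℕ =>
        ENNReal.ofReal ((q : ℝ) ^ (1 / min i j) *
          max (distNearestInt ((q : ℝ) * (a : ℝ))) (distNearestInt ((q : ℝ) * b))))) :
    dimH (badPair i j θ ∩ {p : ℝ × ℝ | ∃ x : ℝ, p = (x, (a : ℝ) * x + b)}) = 1 := by
  apply le_antisymm
  · have hsub : badPair i j θ ∩ {p : ℝ × ℝ | ∃ x : ℝ, p = (x, (a : ℝ) * x + b)} ⊆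
        range (fun x : ℝ => (x, (a : ℝ) * x + b)) := by
      rintro p ⟨-, x, rfl⟩
      exact ⟨x, rfl⟩
    refine (dimH_mono hsub).trans ?_
    have hf : ContDiff ℝ 1 (fun x : ℝ => (x, (a : ℝ) * x + b)) := by fun_prop
    simpa using hf.dimH_range_le
  · obtain ⟨κ, hκ0, hβ⟩ := hbeta a b (min i j) (lt_min hi0 hj0) hdio
    have hd : (a.den : ℝ) * (a : ℝ) = a.num := by
      have := Rat.den_mul_eq_num a
      exact_mod_cast this
    have hs : (1 : ℝ) ≤ |(a.den : ℝ)| := by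
      rw [abs_of_pos (by exact_mod_cast a.den_pos)]
      exact_mod_cast a.den_pos
    have haR : (a : ℝ) ≠ 0 := by exact_mod_cast ha
    rcases le_total j i with h | h
    · rw [min_eq_right h] at hβ
      have hS := core i j ((a.den : ℝ) * b) θ.1 (((a.den : ℤ) : ℝ) * θ.2 - a.num * θ.1) κ
        (by linarith) hi1.le hj0 hj1.le hij hκ0 hβ
      refine hS.trans (le_trans (dimH_mono ?_) (LipschitzWith.prod_fst.dimH_image_le
        (badPair i j θ ∩ {p : ℝ × ℝ | ∃ x : ℝ, p = (x, (a : ℝ) * x + b)})))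
      intro x hx
      refine ⟨(x, (a : ℝ) * x + b), ⟨?_, x, rfl⟩, rfl⟩
      refine incl i j hj0 h (a.den : ℤ) a.num ?_ _ θ.1 θ.2 x ((a : ℝ) * x + b) ?_ hx
      · push_cast
        linarith [abs_nonneg (a.num : ℝ)]
      · push_cast
        linear_combination x * hd
    · rw [min_eq_left h] at hβ
      have hS := core j i ((a.den : ℝ) * b) θ.2
        (((-a.num : ℤ) : ℝ) * θ.1 - ((-(a.den : ℤ) : ℤ) : ℝ) * θ.2) κ
        (by linarith) hj1.le hi0 hi1.le (by linarith) hκ0 hβ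
      refine hS.trans (le_trans (dimH_mono ?_) (LipschitzWith.prod_snd.dimH_image_le
        (badPair i j θ ∩ {p : ℝ × ℝ | ∃ x : ℝ, p = (x, (a : ℝ) * x + b)})))
      intro y hy
      have hxy : (a : ℝ) * ((y - b) / a) + b = y := by field_simp; ring
      refine ⟨((y - b) / a, y), ⟨?_, (y - b) / a, by rw [hxy]⟩, rfl⟩
      obtain ⟨c, hc, H⟩ := incl j i hi0 h (-a.num) (-(a.den : ℤ)) (by
          push_cast
          rw [abs_neg, abs_neg]
          linarith [abs_nonneg (a.num : ℝ)]) _ θ.2 θ.1 y ((y - b) / a) (by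
          push_cast
          rw [← hd]
          field_simp
          ring) hy
      refine ⟨c, hc, fun q hq => ?_⟩
      rw [max_comm]
      exact H q hq
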